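/- Let Λ be the Bedford–McMullen carpet with a_1 = 3, a_2 = 2 and digit set D = {(0,0),(1,1),(2,0)}, and define φ : Σ → ℝ by φ(ω) = 1 if ω_1 = (1,1) and φ(ω) = 0 otherwise. Then dim_H Λ < dim_P Λ, and yet for every α ∈ [0,1], dim_P Π(E_φ(α)) = dim_H Π(E_φ(α)) = (−α log α − (1−α) log(1−α))/log 2 + (1−α)·(log 2/log 3) (with the convention 0·log 0 = 0). In particular the packing spectrum of φ never attains dim_P Λ. -/

import Mathlib

open MeasureTheory Filter Topology Metric Set
open scoped ENNReal NNReal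

noncomputable section

/-- Shannon entropy of the partition of `X` induced by a map into a finite type. -/
def entPart {X : Type*} [MeasurableSpace X] (μ : Measure X) {ι : Type*} [Fintype ι]
    (p : X → ι) : ℝ :=
  ∑ i, Real.negMulLog ((μ (p ⁻¹' {i})).toReal)

/-- Kolmogorov–Sinai (measure-theoretic) entropy of `T` with respect to `μ`:
the supremum over finite measurable partitions (coded by measurable maps into `Fin m`)
of the limit (= infimum, by subadditivity) of the averaged entropies of the dynamical
refinements of the partition. -/
def ksEntropy {X : Type*} [MeasurableSpace X] (T : X → X) (μ : Measure X) : ℝ :=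
  ⨆ m : ℕ, ⨆ p : {p : X → Fin m // Measurable p},
    ⨅ n : ℕ, ((n : ℝ) + 1)⁻¹ *
      entPart μ (fun x => fun k : Fin (n + 1) => p.1 (T^[(k : ℕ)] x))

/-- Minimal number of balls of radius `r` needed to cover `s`. -/
def coverN {X : Type*} [PseudoMetricSpace X] (s : Set X) (r : ℝ) : ℕ :=
  sInf {n : ℕ | ∃ t : Finset X, t.card = n ∧ s ⊆ ⋃ x ∈ t, Metric.ball x r}

/-- Upper box (Minkowski) dimension. -/
def upperBoxDim {X : Type*} [PseudoMetricSpace X] (s : Set X) : ℝ :=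
  Filter.limsup (fun r : ℝ => Real.log (coverN s r) / Real.log r⁻¹) (nhdsWithin 0 (Set.Ioi 0))

/-- Packing dimension, via countable covers and upper box dimension. -/
def packingDim {X : Type*} [PseudoMetricSpace X] (s : Set X) : ℝ :=
  ⨅ C : {C : ℕ → Set X // s ⊆ ⋃ n, C n}, ⨆ n, upperBoxDim (C.1 n)

/-- The `n`-th empirical (Birkhoff average) measure `A_{n+1}(δ_x)` of the orbit of `x`. -/
def empirical {X : Type*} [MeasurableSpace X] (T : X → X) (x : X) (n : ℕ) : Measure X :=
  (((n : ℝ≥0∞) + 1))⁻¹ • ∑ l ∈ Finset.range (n + 1), Measure.dirac (T^[l] x)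

instance empirical_prob {X : Type*} [MeasurableSpace X] (T : X → X) (x : X) (n : ℕ) :
    IsProbabilityMeasure (empirical T x n) := by
  constructor
  have h : ∀ l : ℕ, Measure.dirac (T^[l] x) (Set.univ : Set X) = 1 := fun l => by
    simp [measure_univ]
  simp only [empirical, Measure.smul_apply, Measure.coe_finset_sum, Finset.sum_apply, h,
    Finset.sum_const, Finset.card_range, nsmul_eq_mul, mul_one, smul_eq_mul]
  rw [Nat.cast_add, Nat.cast_one, ENNReal.inv_mul_cancel] <;> simp [Nat.cast_add_one_ne_zero]

/-- The `n`-th empirical measure as a probability measure. -/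
def empiricalPM {X : Type*} [MeasurableSpace X] (T : X → X) (x : X) (n : ℕ) :
    ProbabilityMeasure X := ⟨empirical T x n, empirical_prob T x n⟩

/-- `V(x)`: the set of weak* accumulation points of the sequence of empirical measures of `x`. -/
def accPts {X : Type*} [MeasurableSpace X] [TopologicalSpace X] [OpensMeasurableSpace X]
    (T : X → X) (x : X) : Set (ProbabilityMeasure X) :=
  {μ | MapClusterPt μ atTop (fun n => empiricalPM T x n)}

/-- A probability measure is invariant for `T`. -/
def IsInvariantPM {X : Type*} [MeasurableSpace X] (T : X → X)
    (μ : ProbabilityMeasure X) : Prop :=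
  (μ : Measure X).map T = (μ : Measure X)

/-- Convexity of a set of probability measures. -/
def IsConvexPMSet {X : Type*} [MeasurableSpace X] (A : Set (ProbabilityMeasure X)) : Prop :=
  ∀ μ ∈ A, ∀ ν ∈ A, ∀ t : ℝ≥0, t ≤ 1 → ∀ ρ : ProbabilityMeasure X,
    (ρ : Measure X) = t • (μ : Measure X) + (1 - t) • (ν : Measure X) → ρ ∈ A


/-- The left shift. -/
def shiftMap {β : Type*} (ω : ℕ → β) : ℕ → β := fun n => ω (n + 1)

/-- The digit set `D = {(0,0), (1,1), (2,0)}` of the Bedford–McMullen carpet with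
`a₁ = 3`, `a₂ = 2`. -/
abbrev CarpetDigit : Type :=
  {v : ℕ × ℕ // v ∈ ({(0, 0), (1, 1), (2, 0)} : Finset (ℕ × ℕ))}

/-- The symbolic space `Σ = D^ℕ`. -/
abbrev CarpetSymb : Type := ℕ → CarpetDigit

/-- The coding map `Π : Σ → 𝕋²`, `ω ↦ (Σ i₁(ν) 3^{-ν}, Σ i₂(ν) 2^{-ν})`. -/
def carpetCoding (ω : CarpetSymb) : AddCircle (1 : ℝ) × AddCircle (1 : ℝ) :=
  (((∑' ν : ℕ, ((ω ν).1.1 : ℝ) / 3 ^ (ν + 1) : ℝ) : AddCircle (1 : ℝ)),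
   ((∑' ν : ℕ, ((ω ν).1.2 : ℝ) / 2 ^ (ν + 1) : ℝ) : AddCircle (1 : ℝ)))

/-- The Bedford–McMullen carpet `Λ`. -/
def carpet : Set (AddCircle (1 : ℝ) × AddCircle (1 : ℝ)) := Set.range carpetCoding

/-- The Birkhoff level set `E_φ(α) ⊆ Σ`. -/
def carpetLevel (φ : CarpetSymb → ℝ) (α : ℝ) : Set CarpetSymb :=
  {ω | Tendsto (fun n : ℕ =>
    (n : ℝ)⁻¹ * ∑ r ∈ Finset.range n, φ (shiftMap^[r] ω)) atTop (𝓝 α)}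

/-- The potential `φ(ω) = 1` if `ω₁ = (1,1)`, `φ(ω) = 0` otherwise. -/
def phiEx1 (ω : CarpetSymb) : ℝ := if (ω 0).1 = (1, 1) then 1 else 0

/-- The claimed value of both spectra:
`(-α log α - (1-α) log(1-α))/log 2 + (1-α) log 2/log 3`. -/
def specEx1 (α : ℝ) : ℝ :=
  (Real.negMulLog α + Real.negMulLog (1 - α)) / Real.log 2 +
    (1 - α) * (Real.log 2 / Real.log 3)

/-- The value `∑ c_ν b^{-(ν+1)}` of the base-`b` expansion with digits `c`. -/
def radixVal (b : ℕ) (c : ℕ → ℕ) : ℝ := ∑' ν : ℕ, (c ν : ℝ) / (b : ℝ) ^ (ν + 1)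

/-- The integer whose base-`b` digits are the first `n` digits of `c`. -/
def radixPrefix (b : ℕ) (c : ℕ → ℕ) : ℕ → ℕ
  | 0 => 0
  | n + 1 => b * radixPrefix b c n + c n

section Radix

variable {b : ℕ}

lemma radix_hasSum_geometric (hb : 2 ≤ b) :
    HasSum (fun ν : ℕ => ((b : ℝ) - 1) / (b : ℝ) ^ (ν + 1)) 1 := by
  have hb' : (2 : ℝ) ≤ b := by exact_mod_cast hb
  have h := (hasSum_geometric_of_lt_one (r := (b : ℝ)⁻¹) (by positivity)
    (inv_lt_one_of_one_lt₀ (by linarith))).mul_left (((b : ℝ) - 1) / b)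
  have hb0 : (b : ℝ) - 1 ≠ 0 := by linarith
  have hb1 : (b : ℝ) ≠ 0 := by linarith
  have h1 : ((b : ℝ) - 1) / b * (1 - (b : ℝ)⁻¹)⁻¹ = 1 := by
    have : (1 : ℝ) - (b : ℝ)⁻¹ = ((b : ℝ) - 1) / b := by field_simp
    rw [this]
    field_simp
  rw [h1] at h
  have h2 : (fun ν : ℕ => ((b : ℝ) - 1) / (b : ℝ) ^ (ν + 1)) =
      fun ν => ((b : ℝ) - 1) / b * (b : ℝ)⁻¹ ^ ν := by
    ext ν
    rw [inv_pow, pow_succ]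
    field_simp
  rw [h2]
  exact h

lemma radix_term_le {c : ℕ → ℕ} (hc : ∀ ν, c ν < b) (ν : ℕ) :
    (c ν : ℝ) / (b : ℝ) ^ (ν + 1) ≤ ((b : ℝ) - 1) / (b : ℝ) ^ (ν + 1) := by
  have : (c ν : ℝ) + 1 ≤ b := by exact_mod_cast hc ν
  gcongr
  linarith

lemma radix_summable (hb : 2 ≤ b) {c : ℕ → ℕ} (hc : ∀ ν, c ν < b) :
    Summable fun ν : ℕ => (c ν : ℝ) / (b : ℝ) ^ (ν + 1) :=
  Summable.of_nonneg_of_le (fun ν => by positivity) (radix_term_le hc)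
    (radix_hasSum_geometric hb).summable

lemma radixVal_nonneg (c : ℕ → ℕ) : 0 ≤ radixVal b c :=
  tsum_nonneg fun ν => by positivity

lemma radixVal_le_one (hb : 2 ≤ b) {c : ℕ → ℕ} (hc : ∀ ν, c ν < b) : radixVal b c ≤ 1 := by
  rw [← (radix_hasSum_geometric hb).tsum_eq]
  exact (radix_summable hb hc).tsum_le_tsum (radix_term_le hc) (radix_hasSum_geometric hb).summable

lemma radixVal_step (hb : 2 ≤ b) {c : ℕ → ℕ} (hc : ∀ ν, c ν < b) :
    b * radixVal b c = c 0 + radixVal b (fun ν => c (ν + 1)) := by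
  have hb1 : (b : ℝ) ≠ 0 := by positivity
  rw [radixVal, (radix_summable hb hc).tsum_eq_zero_add, mul_add, ← tsum_mul_left, radixVal]
  congr 1
  · rw [zero_add, pow_one, mul_div_cancel₀ _ hb1]
  · congr 1
    ext ν
    rw [pow_succ (b : ℝ) (ν + 1)]
    field_simp

lemma pow_mul_radixVal (hb : 2 ≤ b) {c : ℕ → ℕ} (hc : ∀ ν, c ν < b) (n : ℕ) :
    (b : ℝ) ^ n * radixVal b c = radixPrefix b c n + radixVal b (fun ν => c (ν + n)) := by
  induction n with
  | zero => simp [radixPrefix]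
  | succ n ih =>
    have h := radixVal_step hb (c := fun ν => c (ν + n)) (fun ν => hc _)
    simp only [zero_add] at h
    rw [pow_succ', mul_assoc, ih, mul_add, h, radixPrefix]
    push_cast
    simp only [add_assoc, add_comm 1 n]

lemma abs_pow_mul_radixVal_sub_le (hb : 2 ≤ b) {c : ℕ → ℕ} (hc : ∀ ν, c ν < b) (n : ℕ) :
    0 ≤ (b : ℝ) ^ n * radixVal b c - radixPrefix b c n ∧
      (b : ℝ) ^ n * radixVal b c - radixPrefix b c n ≤ 1 := by
  rw [pow_mul_radixVal hb hc n, add_sub_cancel_left]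
  exact ⟨radixVal_nonneg _, radixVal_le_one hb fun ν => hc _⟩

lemma radixPrefix_congr {c c' : ℕ → ℕ} {n : ℕ} (h : ∀ k < n, c k = c' k) :
    radixPrefix b c n = radixPrefix b c' n := by
  induction n with
  | zero => rfl
  | succ n ih =>
    rw [radixPrefix, radixPrefix, ih fun k hk => h k (by omega), h n (by omega)]

lemma eq_of_radixPrefix_eq {c c' : ℕ → ℕ} (hc : ∀ ν, c ν < b) (hc' : ∀ ν, c' ν < b) {n : ℕ}
    (h : radixPrefix b c n = radixPrefix b c' n) : ∀ k < n, c k = c' k := by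
  induction n with
  | zero => intro k hk; omega
  | succ n ih =>
    rw [radixPrefix, radixPrefix] at h
    have h1 : c n = c' n := by
      have := congrArg (· % b) h
      simpa [Nat.mul_add_mod, Nat.mod_eq_of_lt (hc n), Nat.mod_eq_of_lt (hc' n)] using this
    have h2 : radixPrefix b c n = radixPrefix b c' n := by
      rw [h1] at h
      exact Nat.eq_of_mul_eq_mul_left (lt_of_le_of_lt (Nat.zero_le _) (hc 0)) (by omega)
    intro k hk
    rcases Nat.lt_succ_iff_lt_or_eq.1 hk with hk | rfl
    · exact ih h2 k hk
    · exact h1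

lemma abs_radixVal_sub_le (hb : 2 ≤ b) {c c' : ℕ → ℕ} (hc : ∀ ν, c ν < b) (hc' : ∀ ν, c' ν < b)
    {n : ℕ} (h : ∀ k < n, c k = c' k) :
    |radixVal b c - radixVal b c'| ≤ ((b : ℝ) ^ n)⁻¹ := by
  have h1 := abs_pow_mul_radixVal_sub_le hb hc n
  have h2 := abs_pow_mul_radixVal_sub_le hb hc' n
  rw [radixPrefix_congr h] at h1
  have hp : 0 < (b : ℝ) ^ n := by positivity
  have h3 : |(b : ℝ) ^ n * (radixVal b c - radixVal b c')| ≤ 1 := by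
    rw [abs_le]; constructor <;> linarith
  rw [abs_mul, abs_of_pos hp] at h3
  rw [← one_div, le_div_iff₀ hp]
  linarith

lemma radixPrefix_mem_of_dist_le (hb : 2 ≤ b) {c c' : ℕ → ℕ} (hc : ∀ ν, c ν < b)
    (hc' : ∀ ν, c' ν < b) {n : ℕ}
    (h : dist (radixVal b c : AddCircle (1 : ℝ)) (radixVal b c') ≤ ((b : ℝ) ^ n)⁻¹) :
    (radixPrefix b c n : ℤ) ∈ (Finset.Icc (-1 : ℤ) 1 ×ˢ Finset.Icc (-2 : ℤ) 2).image
      fun p => (radixPrefix b c' n : ℤ) + p.1 * (b : ℤ) ^ n + p.2 := by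
  have h1 := abs_pow_mul_radixVal_sub_le hb hc n
  have h2 := abs_pow_mul_radixVal_sub_le hb hc' n
  have hp : 0 < (b : ℝ) ^ n := by positivity
  set x := radixVal b c
  set y := radixVal b c'
  have hx0 : 0 ≤ x := radixVal_nonneg _
  have hy0 : 0 ≤ y := radixVal_nonneg _
  have hx1 : x ≤ 1 := radixVal_le_one hb hc
  have hy1 : y ≤ 1 := radixVal_le_one hb hc'
  rw [dist_eq_norm, ← AddCircle.coe_sub, AddCircle.norm_eq] at h
  simp only [inv_one, one_mul, mul_one] at h
  set k := round (x - y) with hk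
  have hr := abs_sub_round (x - y)
  rw [← hk, abs_le] at hr
  rw [← one_div, le_div_iff₀ hp, ← abs_of_pos hp, ← abs_mul, abs_le] at h
  have k1 : -1 ≤ k := by
    have : (-2 : ℝ) < k := by linarith
    have : (-2 : ℤ) < k := by exact_mod_cast this
    omega
  have k2 : k ≤ 1 := by
    have : (k : ℝ) < 2 := by linarith
    have : k < 2 := by exact_mod_cast this
    omega
  rw [Finset.mem_image]
  refine ⟨(k, (radixPrefix b c n : ℤ) - radixPrefix b c' n - k * (b : ℤ) ^ n), ?_, by ring⟩
  rw [Finset.mem_product, Finset.mem_Icc, Finset.mem_Icc]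
  refine ⟨⟨k1, k2⟩, ?_, ?_⟩
  · have : (-2 : ℝ) ≤ ((radixPrefix b c n : ℤ) - radixPrefix b c' n - k * (b : ℤ) ^ n : ℤ) := by
      push_cast; nlinarith
    exact_mod_cast this
  · have : (((radixPrefix b c n : ℤ) - radixPrefix b c' n - k * (b : ℤ) ^ n : ℤ) : ℝ) ≤ 2 := by
      push_cast; nlinarith
    exact_mod_cast this

/-- At most fifteen base-`b` intervals of level `n` meet a short arc of the circle. -/
lemma exists_finset_radixPrefix_mem (hb : 2 ≤ b) {c' : ℕ → ℕ} (hc' : ∀ ν, c' ν < b) (n : ℕ) :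
    ∃ F : Finset ℤ, F.card ≤ 15 ∧ ∀ c : ℕ → ℕ, (∀ ν, c ν < b) →
      dist (radixVal b c : AddCircle (1 : ℝ)) (radixVal b c') ≤ ((b : ℝ) ^ n)⁻¹ →
        (radixPrefix b c n : ℤ) ∈ F :=
  ⟨_, Finset.card_image_le.trans (by simp), fun _ hc h => radixPrefix_mem_of_dist_le hb hc hc' h⟩

end Radix

section Blocks

/-- The exponent `log 2 / log 3` relating the two contraction rates. -/
def carpetRatio : ℝ := Real.log 2 / Real.log 3

lemma carpetRatio_pos : 0 < carpetRatio :=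
  div_pos (Real.log_pos (by norm_num)) (Real.log_pos (by norm_num))

lemma carpetRatio_lt_one : carpetRatio < 1 :=
  (div_lt_one (Real.log_pos (by norm_num))).2 (Real.log_lt_log (by norm_num) (by norm_num))

lemma carpetRatio_mul_log_three : carpetRatio * Real.log 3 = Real.log 2 :=
  div_mul_cancel₀ _ (Real.log_pos (by norm_num)).ne'

/-- The number of full digits prescribed by an approximate square of side about `2 ^ (-n)`. -/
def colLen (n : ℕ) : ℕ := ⌊carpetRatio * n⌋₊

lemma colLen_le_mul (n : ℕ) : (colLen n : ℝ) ≤ carpetRatio * n :=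
  Nat.floor_le (mul_nonneg carpetRatio_pos.le n.cast_nonneg)

lemma mul_lt_colLen_add_one (n : ℕ) : carpetRatio * n < colLen n + 1 :=
  Nat.lt_floor_add_one _

lemma colLen_le (n : ℕ) : colLen n ≤ n := by
  have h := colLen_le_mul n
  have : carpetRatio * n ≤ n := mul_le_of_le_one_left n.cast_nonneg carpetRatio_lt_one.le
  exact_mod_cast h.trans this

lemma rpow_carpetRatio_mul (n : ℕ) : (3 : ℝ) ^ (carpetRatio * n) = 2 ^ n := by
  rw [Real.rpow_def_of_pos (by norm_num), ← mul_assoc, mul_comm (Real.log 3),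
    carpetRatio_mul_log_three, ← Real.rpow_natCast 2 n, Real.rpow_def_of_pos (by norm_num)]

lemma three_pow_colLen_le (n : ℕ) : (3 : ℝ) ^ colLen n ≤ 2 ^ n := by
  rw [← rpow_carpetRatio_mul, ← Real.rpow_natCast]
  exact Real.rpow_le_rpow_of_exponent_le (by norm_num) (colLen_le_mul n)

lemma two_pow_le_three_pow_colLen (n : ℕ) : (2 : ℝ) ^ n ≤ 3 * 3 ^ colLen n := by
  rw [← rpow_carpetRatio_mul, ← pow_succ', ← Real.rpow_natCast]
  exact Real.rpow_le_rpow_of_exponent_le (by norm_num)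
    (by push_cast; exact (mul_lt_colLen_add_one n).le)

/-- The digit `(0,0)`. -/
def digitZero : CarpetDigit := ⟨(0, 0), by simp⟩

/-- The digit `(1,1)`. -/
def digitOne : CarpetDigit := ⟨(1, 1), by simp⟩

/-- The digit `(2,0)`. -/
def digitTwo : CarpetDigit := ⟨(2, 0), by simp⟩

lemma carpetDigit_cases (d : CarpetDigit) : d = digitZero ∨ d = digitOne ∨ d = digitTwo := by
  obtain ⟨v, hv⟩ := d
  simpa [digitZero, digitOne, digitTwo] using hv

lemma digitOne_ne_zero : digitOne ≠ digitZero := by simp [digitZero, digitOne]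

lemma digitTwo_ne_zero : digitTwo ≠ digitZero := by simp [digitZero, digitTwo]

lemma digitTwo_ne_one : digitTwo ≠ digitOne := by simp [digitOne, digitTwo]

lemma digit_fst_lt (d : CarpetDigit) : d.1.1 < 3 := by
  rcases carpetDigit_cases d with rfl | rfl | rfl <;> simp [digitZero, digitOne, digitTwo]

lemma digit_snd_lt (d : CarpetDigit) : d.1.2 < 2 := by
  rcases carpetDigit_cases d with rfl | rfl | rfl <;> simp [digitZero, digitOne, digitTwo]

lemma digit_ext_fst {d e : CarpetDigit} (h : d.1.1 = e.1.1) : d = e := by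
  rcases carpetDigit_cases d with rfl | rfl | rfl <;>
  rcases carpetDigit_cases e with rfl | rfl | rfl <;>
  simp_all [digitZero, digitOne, digitTwo]

/-- A canonical digit in the row of `d`. -/
def rowRep (d : CarpetDigit) : CarpetDigit := if d = digitOne then digitOne else digitZero

lemma rowRep_eq_iff (d e : CarpetDigit) : rowRep d = rowRep e ↔ d.1.2 = e.1.2 := by
  rcases carpetDigit_cases d with rfl | rfl | rfl <;>
  rcases carpetDigit_cases e with rfl | rfl | rfl <;>
  simp [rowRep, digitZero, digitOne, digitTwo]

/-- The approximate square of level `n` containing `ω`: the first `colLen n` digits, and the rows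
of the next ones up to `n`. -/
def carpetBlock (n : ℕ) (ω : CarpetSymb) : Fin n → CarpetDigit :=
  fun k => if (k : ℕ) < colLen n then ω k else rowRep (ω k)

lemma carpetBlock_eq_iff (n : ℕ) (ω ω' : CarpetSymb) :
    carpetBlock n ω = carpetBlock n ω' ↔
      (∀ k < colLen n, (ω k).1.1 = (ω' k).1.1) ∧ ∀ k < n, (ω k).1.2 = (ω' k).1.2 := by
  constructor
  · intro h
    have key : ∀ k < n, (k < colLen n → ω k = ω' k) ∧ (ω k).1.2 = (ω' k).1.2 := by
      intro k hk
      have hk' := congrFun h ⟨k, hk⟩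
      simp only [carpetBlock] at hk'
      split_ifs at hk' with hl
      · exact ⟨fun _ => hk', by rw [hk']⟩
      · exact ⟨fun h => absurd h hl, (rowRep_eq_iff _ _).1 hk'⟩
    exact ⟨fun k hk => by rw [(key k (hk.trans_le (colLen_le n))).1 hk], fun k hk => (key k hk).2⟩
  · rintro ⟨h1, h2⟩
    ext1 k
    simp only [carpetBlock]
    split_ifs with hl
    · exact digit_ext_fst (h1 k hl)
    · exact (rowRep_eq_iff _ _).2 (h2 k k.2)

lemma carpetCoding_eq (ω : CarpetSymb) : carpetCoding ω =
    ((radixVal 3 fun k => (ω k).1.1 : AddCircle (1 : ℝ)),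
      (radixVal 2 fun k => (ω k).1.2 : AddCircle (1 : ℝ))) := by
  simp [carpetCoding, radixVal]

lemma dist_coe_le (x y : ℝ) : dist (x : AddCircle (1 : ℝ)) y ≤ |x - y| := by
  rw [dist_eq_norm, ← AddCircle.coe_sub]
  exact QuotientAddGroup.norm_mk_le_norm

lemma dist_carpetCoding_le {n : ℕ} {ω ω' : CarpetSymb} (h : carpetBlock n ω = carpetBlock n ω') :
    dist (carpetCoding ω) (carpetCoding ω') ≤ 3 * (2 ^ n)⁻¹ := by
  obtain ⟨h1, h2⟩ := (carpetBlock_eq_iff n ω ω').1 h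
  rw [carpetCoding_eq, carpetCoding_eq, Prod.dist_eq]
  refine max_le ?_ ?_
  · refine (dist_coe_le _ _).trans ((abs_radixVal_sub_le (by norm_num) (fun k => digit_fst_lt _)
      (fun k => digit_fst_lt _) h1).trans ?_)
    have := two_pow_le_three_pow_colLen n
    rw [← div_eq_mul_inv, ← one_div, div_le_div_iff₀ (by positivity) (by positivity)]
    push_cast
    linarith
  · refine (dist_coe_le _ _).trans ((abs_radixVal_sub_le (by norm_num) (fun k => digit_snd_lt _)
      (fun k => digit_snd_lt _) h2).trans ?_)
    push_cast
    have : (0 : ℝ) < (2 ^ n)⁻¹ := by positivity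
    linarith

/-- A set of diameter at most `2 ^ (-n)` meets a bounded number of approximate squares of
level `n`. -/
lemma ncard_carpetBlock_le {n : ℕ} {U : Set (AddCircle (1 : ℝ) × AddCircle (1 : ℝ))}
    (hU : ∀ u ∈ U, ∀ v ∈ U, dist u v ≤ ((2 : ℝ) ^ n)⁻¹) :
    (carpetBlock n '' (carpetCoding ⁻¹' U)).ncard ≤ 225 := by
  rcases (carpetCoding ⁻¹' U).eq_empty_or_nonempty with h0 | ⟨ω₀, h0⟩
  · simp [h0]
  obtain ⟨F, hFc, hF⟩ := exists_finset_radixPrefix_mem (b := 3) (by norm_num)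
    (c' := fun k => (ω₀ k).1.1) (fun k => digit_fst_lt _) (colLen n)
  obtain ⟨G, hGc, hG⟩ := exists_finset_radixPrefix_mem (b := 2) (by norm_num)
    (c' := fun k => (ω₀ k).1.2) (fun k => digit_snd_lt _) n
  have key : ∀ v ∈ carpetBlock n '' (carpetCoding ⁻¹' U), ∃ ω, carpetCoding ω ∈ U ∧
      carpetBlock n ω = v := fun v ⟨ω, h⟩ => ⟨ω, h⟩
  have : Nonempty CarpetSymb := ⟨ω₀⟩
  choose! w hwU hwv using key
  let g : (Fin n → CarpetDigit) → ℤ × ℤ := fun v =>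
    ((radixPrefix 3 (fun k => (w v k).1.1) (colLen n) : ℤ),
      (radixPrefix 2 (fun k => (w v k).1.2) n : ℤ))
  have hmaps : ∀ v ∈ carpetBlock n '' (carpetCoding ⁻¹' U), g v ∈ ((F ×ˢ G : Finset (ℤ × ℤ)) :
      Set (ℤ × ℤ)) := by
    intro v hv
    have hd := hU _ (hwU v hv) _ h0
    rw [carpetCoding_eq, carpetCoding_eq, Prod.dist_eq, max_le_iff] at hd
    rw [Finset.mem_coe, Finset.mem_product]
    refine ⟨hF _ (fun k => digit_fst_lt _) (hd.1.trans ?_),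
      hG _ (fun k => digit_snd_lt _) (hd.2.trans ?_)⟩
    · push_cast
      exact inv_anti₀ (by positivity) (three_pow_colLen_le n)
    · push_cast
      exact le_rfl
  have hinj : InjOn g (carpetBlock n '' (carpetCoding ⁻¹' U)) := by
    intro v hv v' hv' hg
    simp only [g, Prod.mk.injEq, Nat.cast_inj] at hg
    rw [← hwv v hv, ← hwv v' hv', carpetBlock_eq_iff]
    exact ⟨eq_of_radixPrefix_eq (fun k => digit_fst_lt _) (fun k => digit_fst_lt _) hg.1,
      eq_of_radixPrefix_eq (fun k => digit_snd_lt _) (fun k => digit_snd_lt _) hg.2⟩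
  have h := Set.ncard_le_ncard_of_injOn g hmaps hinj (Finset.finite_toSet _)
  rw [Set.ncard_coe_finset, Finset.card_product] at h
  exact h.trans (Nat.mul_le_mul hFc hGc)

lemma continuous_carpetCoding : Continuous carpetCoding := by
  have key : ∀ b : ℕ, 2 ≤ b → ∀ g : CarpetDigit → ℕ, (∀ d, g d < b) →
      Continuous fun ω : CarpetSymb => radixVal b fun k => g (ω k) := by
    intro b hb g hg
    refine continuous_tsum (u := fun ν : ℕ => ((b : ℝ) - 1) / (b : ℝ) ^ (ν + 1)) (fun ν => ?_)
      (radix_hasSum_geometric hb).summable fun ν ω => ?_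
    · have : Continuous fun d : CarpetDigit => (g d : ℝ) / (b : ℝ) ^ (ν + 1) :=
        continuous_of_discreteTopology
      exact this.comp (continuous_apply ν)
    · rw [Real.norm_of_nonneg (by positivity)]
      exact radix_term_le (c := fun k => g (ω k)) (fun k => hg _) ν
  have h : carpetCoding = fun ω => ((radixVal 3 fun k => (ω k).1.1 : AddCircle (1 : ℝ)),
      (radixVal 2 fun k => (ω k).1.2 : AddCircle (1 : ℝ))) := funext carpetCoding_eq
  rw [h]
  exact ((AddCircle.continuous_mk' 1).comp (key 3 (by norm_num) (fun d => d.1.1) digit_fst_lt)).prodMk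
    ((AddCircle.continuous_mk' 1).comp (key 2 (by norm_num) (fun d => d.1.2) digit_snd_lt))

end Blocks

section Dimensions

lemma coverN_le_card {X : Type*} [PseudoMetricSpace X] {s : Set X} {r : ℝ} (t : Finset X)
    (h : s ⊆ ⋃ x ∈ t, ball x r) : coverN s r ≤ t.card :=
  Nat.sInf_le ⟨t, rfl, h⟩

lemma exists_circle_net {r : ℝ} (hr : 0 < r) : ∃ t : Finset (AddCircle (1 : ℝ)),
    t.card ≤ ⌊r⁻¹⌋₊ + 1 ∧ ∀ x, ∃ y ∈ t, dist x y < r := by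
  set n := ⌊r⁻¹⌋₊ + 1 with hn
  have hn0 : (0 : ℝ) < n := by positivity
  have hnr : r⁻¹ < n := by
    rw [hn]
    push_cast
    exact Nat.lt_floor_add_one _
  classical
  refine ⟨(Finset.range n).image fun i : ℕ => (((i : ℝ) / n : ℝ) : AddCircle (1 : ℝ)),
    Finset.card_image_le.trans (by simp), fun x => ?_⟩
  obtain ⟨u, hu, rfl⟩ : ∃ u : ℝ, u ∈ Ico (0 : ℝ) 1 ∧ (u : AddCircle (1 : ℝ)) = x := by
    have := AddCircle.coe_image_Ico_eq (1 : ℝ) 0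
    rw [zero_add] at this
    have hx : x ∈ (univ : Set (AddCircle (1 : ℝ))) := mem_univ x
    rw [← this] at hx
    exact hx
  have hun : 0 ≤ u * n := mul_nonneg hu.1 hn0.le
  refine ⟨_, Finset.mem_image.2 ⟨⌊u * n⌋₊, ?_, rfl⟩, ?_⟩
  · rw [Finset.mem_range, Nat.floor_lt hun]
    nlinarith [hu.2]
  · rw [dist_eq_norm, ← AddCircle.coe_sub]
    refine QuotientAddGroup.norm_mk_le_norm.trans_lt ?_
    have h1 := Nat.floor_le hun
    have h2 := Nat.lt_floor_add_one (u * n)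
    rw [Real.norm_eq_abs]
    have h3 : u - (⌊u * n⌋₊ : ℝ) / n = (u * n - ⌊u * n⌋₊) / n := by field_simp
    rw [h3, abs_of_nonneg (div_nonneg (by linarith) hn0.le), div_lt_iff₀ hn0]
    have : 1 < r * n := by
      rw [inv_eq_one_div, div_lt_iff₀ hr] at hnr
      linarith
    linarith

lemma exists_torus_net {r : ℝ} (hr : 0 < r) :
    ∃ t : Finset (AddCircle (1 : ℝ) × AddCircle (1 : ℝ)),
      t.card ≤ (⌊r⁻¹⌋₊ + 1) ^ 2 ∧ univ ⊆ ⋃ x ∈ t, ball x r := by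
  obtain ⟨t, ht, h⟩ := exists_circle_net hr
  refine ⟨t ×ˢ t, ?_, fun x _ => ?_⟩
  · rw [Finset.card_product, sq]
    exact Nat.mul_le_mul ht ht
  · obtain ⟨y, hy, hy'⟩ := h x.1
    obtain ⟨z, hz, hz'⟩ := h x.2
    refine mem_iUnion₂.2 ⟨(y, z), Finset.mem_product.2 ⟨hy, hz⟩, ?_⟩
    rw [mem_ball, Prod.dist_eq]
    exact max_lt hy' hz'

variable {s : Set (AddCircle (1 : ℝ) × AddCircle (1 : ℝ))}

lemma exists_finset_coverN (s : Set (AddCircle (1 : ℝ) × AddCircle (1 : ℝ))) {r : ℝ}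
    (hr : 0 < r) : ∃ t : Finset (AddCircle (1 : ℝ) × AddCircle (1 : ℝ)),
      t.card = coverN s r ∧ s ⊆ ⋃ x ∈ t, ball x r := by
  obtain ⟨t, -, h⟩ := exists_torus_net hr
  exact Nat.sInf_mem (s := {n : ℕ | ∃ t : Finset (AddCircle (1 : ℝ) × AddCircle (1 : ℝ)),
    t.card = n ∧ s ⊆ ⋃ x ∈ t, ball x r}) ⟨_, t, rfl, (subset_univ s).trans h⟩

lemma eventually_small_radius : ∀ᶠ r : ℝ in 𝓝[>] 0, 0 < r ∧ r < 1 / 2 ∧ 0 < Real.log r⁻¹ := by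
  filter_upwards [Ioo_mem_nhdsGT (show (0 : ℝ) < 1 / 2 by norm_num)] with r hr
  refine ⟨hr.1, hr.2, Real.log_pos ?_⟩
  rw [one_lt_inv₀ hr.1]
  linarith [hr.2]

lemma eventually_boxRatio_nonneg {X : Type*} [PseudoMetricSpace X] (s : Set X) :
    ∀ᶠ r : ℝ in 𝓝[>] 0, 0 ≤ Real.log (coverN s r) / Real.log r⁻¹ := by
  filter_upwards [eventually_small_radius] with r hr
  exact div_nonneg (Real.log_natCast_nonneg _) hr.2.2.le

lemma eventually_boxRatio_le_four (s : Set (AddCircle (1 : ℝ) × AddCircle (1 : ℝ))) :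
    ∀ᶠ r : ℝ in 𝓝[>] 0, Real.log (coverN s r) / Real.log r⁻¹ ≤ 4 := by
  filter_upwards [eventually_small_radius] with r ⟨h0, h1, h2⟩
  rw [div_le_iff₀ h2]
  rcases Nat.eq_zero_or_pos (coverN s r) with h | h
  · simp only [h, Nat.cast_zero, Real.log_zero]
    positivity
  obtain ⟨t, ht, ht'⟩ := exists_torus_net h0
  have h3 : (coverN s r : ℝ) ≤ (⌊r⁻¹⌋₊ + 1) ^ 2 := by
    exact_mod_cast (coverN_le_card t ((subset_univ s).trans ht')).trans ht
  have h4 := Nat.floor_le (inv_pos.2 h0).le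
  have h5 : 2 < r⁻¹ := by
    rw [lt_inv_comm₀ (by norm_num) h0]
    linarith
  have h6 : (⌊r⁻¹⌋₊ + 1 : ℝ) ≤ r⁻¹ ^ 2 := by nlinarith
  have h7 : (coverN s r : ℝ) ≤ r⁻¹ ^ 4 := h3.trans (by
    calc (⌊r⁻¹⌋₊ + 1 : ℝ) ^ 2 ≤ (r⁻¹ ^ 2) ^ 2 := by gcongr
      _ = r⁻¹ ^ 4 := by ring)
  have h8 := Real.log_le_log (by exact_mod_cast h) h7
  rwa [Real.log_pow] at h8

lemma boxRatio_isBoundedUnder (s : Set (AddCircle (1 : ℝ) × AddCircle (1 : ℝ))) :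
    IsBoundedUnder (· ≤ ·) (𝓝[>] (0 : ℝ)) fun r : ℝ => Real.log (coverN s r) / Real.log r⁻¹ :=
  isBoundedUnder_of_eventually_le (eventually_boxRatio_le_four s)

lemma boxRatio_isCoboundedUnder {X : Type*} [PseudoMetricSpace X] (s : Set X) :
    IsCoboundedUnder (· ≤ ·) (𝓝[>] (0 : ℝ)) fun r : ℝ => Real.log (coverN s r) / Real.log r⁻¹ :=
  (isBoundedUnder_of_eventually_ge (eventually_boxRatio_nonneg s)).isCoboundedUnder_le

lemma upperBoxDim_le_of_eventually {X : Type*} [PseudoMetricSpace X] {s : Set X} {t : ℝ}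
    (h : ∀ᶠ r : ℝ in 𝓝[>] 0, Real.log (coverN s r) / Real.log r⁻¹ ≤ t) : upperBoxDim s ≤ t :=
  limsup_le_of_le (boxRatio_isCoboundedUnder s) h

lemma le_upperBoxDim_of_frequently {t : ℝ}
    (h : ∃ᶠ r : ℝ in 𝓝[>] 0, t ≤ Real.log (coverN s r) / Real.log r⁻¹) : t ≤ upperBoxDim s :=
  le_limsup_of_frequently_le h (boxRatio_isBoundedUnder s)

lemma upperBoxDim_nonneg (s : Set (AddCircle (1 : ℝ) × AddCircle (1 : ℝ))) :
    0 ≤ upperBoxDim s :=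
  le_upperBoxDim_of_frequently (eventually_boxRatio_nonneg s).frequently

lemma upperBoxDim_le_four (s : Set (AddCircle (1 : ℝ) × AddCircle (1 : ℝ))) :
    upperBoxDim s ≤ 4 :=
  upperBoxDim_le_of_eventually (eventually_boxRatio_le_four s)

lemma packingDim_le_of_cover {t : ℝ} (C : ℕ → Set (AddCircle (1 : ℝ) × AddCircle (1 : ℝ)))
    (hC : s ⊆ ⋃ n, C n) (h : ∀ n, upperBoxDim (C n) ≤ t) : packingDim s ≤ t := by
  refine (ciInf_le ⟨0, ?_⟩ (⟨C, hC⟩ : {C : ℕ → Set _ // s ⊆ ⋃ n, C n})).trans (ciSup_le h)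
  rintro _ ⟨D, rfl⟩
  exact Real.iSup_nonneg fun n => upperBoxDim_nonneg _

lemma le_packingDim_of_forall_cover {t : ℝ}
    (h : ∀ C : ℕ → Set (AddCircle (1 : ℝ) × AddCircle (1 : ℝ)), s ⊆ ⋃ n, C n →
      ∃ n, t ≤ upperBoxDim (C n)) : t ≤ packingDim s := by
  have : Nonempty {C : ℕ → Set (AddCircle (1 : ℝ) × AddCircle (1 : ℝ)) // s ⊆ ⋃ n, C n} :=
    ⟨⟨fun _ => univ, by simp [iUnion_const]⟩⟩
  refine le_ciInf fun C => ?_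
  obtain ⟨n, hn⟩ := h C.1 C.2
  refine hn.trans (le_ciSup (f := fun n => upperBoxDim (C.1 n)) ⟨4, ?_⟩ n)
  rintro _ ⟨m, rfl⟩
  exact upperBoxDim_le_four _

lemma dimH_le_upperBoxDim (s : Set (AddCircle (1 : ℝ) × AddCircle (1 : ℝ))) :
    dimH s ≤ ENNReal.ofReal (upperBoxDim s) := by
  refine le_of_forall_gt_imp_ge_of_dense fun c hc => ?_
  rcases eq_or_ne c ⊤ with rfl | hctop
  · exact le_top
  lift c to ℝ≥0 using hctop
  have hc' : upperBoxDim s < c := by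
    rw [ENNReal.ofReal, ENNReal.coe_lt_coe] at hc
    exact (Real.le_coe_toNNReal _).trans_lt (by exact_mod_cast hc)
  refine dimH_le_of_hausdorffMeasure_ne_top ?_
  have hev : ∀ᶠ r : ℝ in 𝓝[>] 0, Real.log (coverN s r) / Real.log r⁻¹ < c :=
    eventually_lt_of_limsup_lt hc' (boxRatio_isBoundedUnder s)
  have hex : ∀ r : ℝ, ∃ t : Finset (AddCircle (1 : ℝ) × AddCircle (1 : ℝ)),
      0 < r → t.card = coverN s r ∧ s ⊆ ⋃ x ∈ t, ball x r := by
    intro r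
    by_cases hr : 0 < r
    · obtain ⟨t, ht⟩ := exists_finset_coverN s hr
      exact ⟨t, fun _ => ht⟩
    · exact ⟨∅, fun h => absurd h hr⟩
  choose T hT using hex
  have hdiam : ∀ (r : ℝ) (x : AddCircle (1 : ℝ) × AddCircle (1 : ℝ)), 0 < r →
      ediam (ball x r) ≤ ENNReal.ofReal (2 * r) := by
    intro r x hr
    refine ediam_le fun y hy z hz => ?_
    rw [edist_dist]
    refine ENNReal.ofReal_le_ofReal ?_
    rw [mem_ball] at hy hz
    linarith [dist_triangle_right y z x]
  have hlim : Tendsto (fun r : ℝ => ENNReal.ofReal (2 * r)) (𝓝[>] 0) (𝓝 0) := by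
    have : Tendsto (fun r : ℝ => ENNReal.ofReal (2 * r)) (𝓝 0) (𝓝 (ENNReal.ofReal (2 * 0))) :=
      (ENNReal.continuous_ofReal.comp (continuous_const.mul continuous_id)).tendsto _
    rw [mul_zero, ENNReal.ofReal_zero] at this
    exact this.mono_left nhdsWithin_le_nhds
  have hH := Measure.hausdorffMeasure_le_liminf_sum (ι := fun r : ℝ => T r) (c : ℝ) s
    (fun r : ℝ => ENNReal.ofReal (2 * r)) hlim (fun r x => ball x.1 r)
    (by
      filter_upwards [self_mem_nhdsWithin] with r hr x
      exact hdiam r x.1 hr)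
    (by
      filter_upwards [self_mem_nhdsWithin] with r hr
      refine (hT r hr).2.trans ?_
      intro y hy
      obtain ⟨x, hx, hy⟩ := mem_iUnion₂.1 hy
      exact mem_iUnion.2 ⟨⟨x, hx⟩, hy⟩)
  refine ne_top_of_le_ne_top (b := ENNReal.ofReal (2 ^ (c : ℝ))) ENNReal.ofReal_ne_top
    (hH.trans ?_)
  refine liminf_le_of_frequently_le' (Eventually.frequently ?_)
  filter_upwards [hev, eventually_small_radius] with r hr ⟨h0, h1, h2⟩
  have hcard : (coverN s r : ℝ) ≤ r⁻¹ ^ (c : ℝ) := by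
    rcases Nat.eq_zero_or_pos (coverN s r) with h | h
    · rw [h, Nat.cast_zero]
      positivity
    · rw [div_lt_iff₀ h2] at hr
      have := Real.exp_le_exp.2 hr.le
      rwa [Real.exp_log (by exact_mod_cast h), mul_comm, ← Real.rpow_def_of_pos (by positivity)]
        at this
  calc ∑ x : T r, ediam (ball x.1 r) ^ (c : ℝ)
      ≤ ∑ _x : T r, ENNReal.ofReal ((2 * r) ^ (c : ℝ)) := by
        refine Finset.sum_le_sum fun x _ => ?_
        rw [← ENNReal.ofReal_rpow_of_nonneg (by positivity) c.coe_nonneg]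
        exact ENNReal.rpow_le_rpow (hdiam r x.1 h0) c.coe_nonneg
    _ = ENNReal.ofReal (coverN s r * (2 * r) ^ (c : ℝ)) := by
        rw [Finset.sum_const, Finset.card_univ, Fintype.card_coe, (hT r h0).1, nsmul_eq_mul,
          ENNReal.ofReal_mul (by positivity), ENNReal.ofReal_natCast]
    _ ≤ ENNReal.ofReal (2 ^ (c : ℝ)) := by
        refine ENNReal.ofReal_le_ofReal ?_
        calc (coverN s r : ℝ) * (2 * r) ^ (c : ℝ) ≤ r⁻¹ ^ (c : ℝ) * (2 * r) ^ (c : ℝ) := by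
              gcongr
          _ = 2 ^ (c : ℝ) := by
              rw [← Real.mul_rpow (by positivity) (by positivity)]
              congr 1
              field_simp

lemma dimH_le_packingDim (s : Set (AddCircle (1 : ℝ) × AddCircle (1 : ℝ))) :
    dimH s ≤ ENNReal.ofReal (packingDim s) := by
  refine ENNReal.le_of_forall_nnreal_lt fun c hc => ?_
  rw [← ENNReal.ofReal_coe_nnreal]
  refine ENNReal.ofReal_le_ofReal (le_packingDim_of_forall_cover fun C hC => ?_)
  have h1 := hc.trans_le (dimH_mono hC)
  rw [dimH_iUnion, lt_iSup_iff] at h1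
  obtain ⟨n, hn⟩ := h1
  have h2 := hn.trans_le (dimH_le_upperBoxDim (C n))
  rw [← ENNReal.ofReal_coe_nnreal, ENNReal.ofReal_lt_ofReal_iff_of_nonneg c.coe_nonneg] at h2
  exact ⟨n, h2.le⟩

end Dimensions

section Weights

/-- The number of digits `(1,1)` among the first `n` digits of `ω`. -/
def onesCount (ω : CarpetSymb) (n : ℕ) : ℝ :=
  ∑ k ∈ Finset.range n, if ω k = digitOne then (1 : ℝ) else 0

lemma onesCount_nonneg (ω : CarpetSymb) (n : ℕ) : 0 ≤ onesCount ω n :=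
  Finset.sum_nonneg fun k _ => by split_ifs <;> norm_num

lemma onesCount_le (ω : CarpetSymb) (n : ℕ) : onesCount ω n ≤ n := by
  calc onesCount ω n ≤ ∑ _k ∈ Finset.range n, (1 : ℝ) :=
        Finset.sum_le_sum fun k _ => by split_ifs <;> norm_num
    _ = n := by simp

lemma shiftMap_iterate_apply (ω : CarpetSymb) (r k : ℕ) : (shiftMap^[r] ω) k = ω (k + r) := by
  induction r generalizing ω with
  | zero => rfl
  | succ r ih =>
    rw [Function.iterate_succ_apply, ih]
    rfl

lemma mem_carpetLevel_iff (α : ℝ) (ω : CarpetSymb) :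
    ω ∈ carpetLevel phiEx1 α ↔ Tendsto (fun n : ℕ => onesCount ω n / n) atTop (𝓝 α) := by
  have h : ∀ r, phiEx1 (shiftMap^[r] ω) = if ω r = digitOne then 1 else 0 := by
    intro r
    simp only [phiEx1, shiftMap_iterate_apply, zero_add, digitOne, Subtype.ext_iff]
  simp only [carpetLevel, mem_ofPred_eq, h, onesCount, div_eq_inv_mul]

/-- The logarithm of the Bernoulli mass of the level-`n` approximate square containing `ω`. -/
def logWeight (a : ℝ) (n : ℕ) (ω : CarpetSymb) : ℝ :=
  onesCount ω n * Real.log a + (n - onesCount ω n) * Real.log (1 - a) -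
    (colLen n - onesCount ω (colLen n)) * Real.log 2

lemma tendsto_colLen_div : Tendsto (fun n : ℕ => (colLen n : ℝ) / n) atTop (𝓝 carpetRatio) := by
  have h := (tendsto_nat_floor_mul_div_atTop (R := ℝ) carpetRatio_pos.le).comp
    tendsto_natCast_atTop_atTop
  exact h

lemma tendsto_colLen_atTop : Tendsto colLen atTop atTop :=
  tendsto_nat_floor_atTop.comp
    (tendsto_natCast_atTop_atTop.const_mul_atTop carpetRatio_pos)

lemma tendsto_logWeight_div {α : ℝ} {ω : CarpetSymb} (hω : ω ∈ carpetLevel phiEx1 α) (a : ℝ) :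
    Tendsto (fun n : ℕ => logWeight a n ω / n) atTop
      (𝓝 (α * Real.log a + (1 - α) * Real.log (1 - a) -
        (carpetRatio - α * carpetRatio) * Real.log 2)) := by
  rw [mem_carpetLevel_iff] at hω
  have h2 := (hω.comp tendsto_colLen_atTop).mul tendsto_colLen_div
  have h := ((hω.mul_const (Real.log a)).add
    ((hω.const_sub 1).mul_const (Real.log (1 - a)))).sub
      ((tendsto_colLen_div.sub h2).mul_const (Real.log 2))
  refine h.congr' ?_
  filter_upwards [eventually_gt_atTop 0, tendsto_colLen_atTop.eventually_gt_atTop 0]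
    with n hn hl
  have hn' : (n : ℝ) ≠ 0 := by positivity
  have hl' : (colLen n : ℝ) ≠ 0 := by positivity
  simp only [logWeight, Function.comp]
  field_simp

/-- The weights `a` on `(1,1)` and `(1-a)/2` on the two other digits. -/
def digitMeasure (a : unitInterval) : Measure CarpetDigit :=
  ENNReal.ofReal a • Measure.dirac digitOne +
    (ENNReal.ofReal ((1 - a) / 2) • Measure.dirac digitZero +
      ENNReal.ofReal ((1 - a) / 2) • Measure.dirac digitTwo)

lemma digitMeasure_apply (a : unitInterval) (s : Set CarpetDigit) :
    digitMeasure a s = ENNReal.ofReal a * s.indicator 1 digitOne +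
      (ENNReal.ofReal ((1 - a) / 2) * s.indicator 1 digitZero +
        ENNReal.ofReal ((1 - a) / 2) * s.indicator 1 digitTwo) := by
  simp [digitMeasure]

lemma ofReal_half_add_half (a : unitInterval) :
    ENNReal.ofReal ((1 - a) / 2) + ENNReal.ofReal ((1 - a) / 2) = ENNReal.ofReal (1 - a) := by
  have := a.2.2
  rw [← ENNReal.ofReal_add (by linarith) (by linarith), add_halves]

instance digitMeasure_prob (a : unitInterval) : IsProbabilityMeasure (digitMeasure a) := by
  constructor
  have := a.2
  rw [digitMeasure_apply]
  simp only [indicator_univ, Pi.one_apply, mul_one, ofReal_half_add_half]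
  rw [← ENNReal.ofReal_add this.1 (by linarith [this.2])]
  simp

lemma digitMeasure_singleton (a : unitInterval) (d : CarpetDigit) :
    digitMeasure a {d} = ENNReal.ofReal (if d = digitOne then (a : ℝ) else (1 - a) / 2) := by
  rw [digitMeasure_apply]
  rcases carpetDigit_cases d with rfl | rfl | rfl <;>
  simp [digitOne_ne_zero, digitOne_ne_zero.symm, digitTwo_ne_zero, digitTwo_ne_zero.symm,
    digitTwo_ne_one, digitTwo_ne_one.symm]

lemma digitMeasure_row (a : unitInterval) (d : CarpetDigit) :
    digitMeasure a (rowRep ⁻¹' {rowRep d}) =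
      ENNReal.ofReal (if d = digitOne then (a : ℝ) else 1 - a) := by
  rw [digitMeasure_apply]
  rcases carpetDigit_cases d with rfl | rfl | rfl <;>
  simp [rowRep, indicator, digitOne_ne_zero, digitOne_ne_zero.symm,
    digitTwo_ne_one, ofReal_half_add_half]

/-- The Bernoulli measure on the symbolic space with weights `digitMeasure a`. -/
def carpetBernoulli (a : unitInterval) : Measure CarpetSymb :=
  Measure.infinitePi fun _ => digitMeasure a

instance carpetBernoulli_prob (a : unitInterval) : IsProbabilityMeasure (carpetBernoulli a) := by
  unfold carpetBernoulli
  infer_instance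

lemma measurable_carpetBlock (n : ℕ) : Measurable (carpetBlock n) := by
  refine measurable_pi_lambda _ fun k => ?_
  have : Measurable fun d : CarpetDigit => if (k : ℕ) < colLen n then d else rowRep d :=
    Measurable.of_discrete
  exact this.comp (measurable_pi_apply (k : ℕ))

/-- The mass contributed by the digit `d` to a square, either as a full digit or as a row. -/
def digitFactor (a : ℝ) (full : Prop) [Decidable full] (d : CarpetDigit) : ℝ :=
  if d = digitOne then a else if full then (1 - a) / 2 else 1 - a

lemma carpetBernoulli_block (a : unitInterval) (n : ℕ) (ω : CarpetSymb) :
    carpetBernoulli a (carpetBlock n ⁻¹' {carpetBlock n ω}) =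
      ∏ k ∈ Finset.range n, ENNReal.ofReal (digitFactor a (k < colLen n) (ω k)) := by
  have h : carpetBlock n ⁻¹' {carpetBlock n ω} = ((Finset.range n : Finset ℕ) : Set ℕ).pi
      fun k => if k < colLen n then {ω k} else rowRep ⁻¹' {rowRep (ω k)} := by
    ext η
    simp only [mem_preimage, mem_singleton_iff, funext_iff, carpetBlock, Fin.forall_iff, Set.mem_pi,
      Finset.coe_range, mem_Iio]
    refine forall₂_congr fun k _ => ?_
    split_ifs <;> simp
  rw [h, carpetBernoulli, Measure.infinitePi_pi _ fun _ _ => MeasurableSet.of_discrete]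
  refine Finset.prod_congr rfl fun k _ => ?_
  unfold digitFactor
  split_ifs with h1 h2 h2 <;> simp [digitMeasure_singleton, digitMeasure_row, h2]

/-- The logarithm of `digitFactor`. -/
def logDigitFactor (a : ℝ) (full : Prop) [Decidable full] (d : CarpetDigit) : ℝ :=
  (if d = digitOne then 1 else 0) * Real.log a +
    (1 - if d = digitOne then 1 else 0) * Real.log (1 - a) -
      (if full then 1 - (if d = digitOne then 1 else 0) else 0) * Real.log 2

lemma sum_logDigitFactor (a : ℝ) (n : ℕ) (ω : CarpetSymb) :
    ∑ k ∈ Finset.range n, logDigitFactor a (k < colLen n) (ω k) = logWeight a n ω := by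
  have h : (Finset.range n).filter (fun k => k < colLen n) = Finset.range (colLen n) := by
    ext k
    have := colLen_le n
    simp only [Finset.mem_filter, Finset.mem_range]
    omega
  simp only [logDigitFactor, Finset.sum_sub_distrib, Finset.sum_add_distrib, ← Finset.sum_mul,
    ← Finset.sum_filter (fun k => k < colLen n), h, logWeight, onesCount]
  simp

lemma exp_logDigitFactor {a : ℝ} (h0 : 0 < a) (h1 : a < 1) (full : Prop) [Decidable full]
    (d : CarpetDigit) : Real.exp (logDigitFactor a full d) = digitFactor a full d := by
  unfold logDigitFactor digitFactor
  split_ifs <;> simp [Real.exp_sub, Real.exp_log h0, Real.exp_log (sub_pos.2 h1),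
    Real.exp_log (show (0 : ℝ) < 2 by norm_num)]

lemma digitFactor_le_exp {a : ℝ} (full : Prop) [Decidable full] (d : CarpetDigit) :
    digitFactor a full d ≤ Real.exp (logDigitFactor a full d) := by
  have h := Real.le_exp_log (1 - a)
  unfold logDigitFactor digitFactor
  split_ifs <;> simp [Real.exp_sub, Real.le_exp_log,
    Real.exp_log (show (0 : ℝ) < 2 by norm_num)] <;>
  linarith

lemma ofReal_exp_logWeight (a : ℝ) (n : ℕ) (ω : CarpetSymb) :
    ENNReal.ofReal (Real.exp (logWeight a n ω)) =
      ∏ k ∈ Finset.range n, ENNReal.ofReal (Real.exp (logDigitFactor a (k < colLen n) (ω k))) := by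
  rw [← sum_logDigitFactor, Real.exp_sum, ENNReal.ofReal_prod_of_nonneg fun _ _ => (Real.exp_pos _).le]

lemma carpetBernoulli_block_le (a : unitInterval) (n : ℕ) (ω : CarpetSymb) :
    carpetBernoulli a (carpetBlock n ⁻¹' {carpetBlock n ω}) ≤
      ENNReal.ofReal (Real.exp (logWeight a n ω)) := by
  rw [carpetBernoulli_block, ofReal_exp_logWeight]
  exact Finset.prod_le_prod' fun k _ => ENNReal.ofReal_le_ofReal (digitFactor_le_exp _ _)

lemma carpetBernoulli_block_eq {a : unitInterval} (h0 : 0 < (a : ℝ)) (h1 : (a : ℝ) < 1) (n : ℕ)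
    (ω : CarpetSymb) : carpetBernoulli a (carpetBlock n ⁻¹' {carpetBlock n ω}) =
      ENNReal.ofReal (Real.exp (logWeight a n ω)) := by
  rw [carpetBernoulli_block, ofReal_exp_logWeight]
  exact Finset.prod_congr rfl fun k _ => by rw [exp_logDigitFactor h0 h1]

/-- Few approximate squares can have a large weight. -/
lemma ncard_block_image_le {a : ℝ} (h0 : 0 < a) (h1 : a < 1) {n : ℕ} {A : Set CarpetSymb} {c : ℝ}
    (hA : ∀ ω ∈ A, -c ≤ logWeight a n ω) :
    ((carpetBlock n '' A).ncard : ℝ) ≤ Real.exp c := by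
  classical
  set F := (Set.toFinite (carpetBlock n '' A)).toFinset with hF
  rw [Set.ncard_eq_toFinset_card _ (Set.toFinite _), ← hF]
  set a' : unitInterval := ⟨a, h0.le, h1.le⟩
  have hsum : ∑ v ∈ F, carpetBernoulli a' (carpetBlock n ⁻¹' {v}) ≤ 1 := by
    rw [sum_measure_preimage_singleton F fun v _ =>
      measurable_carpetBlock n (measurableSet_singleton v)]
    exact prob_le_one
  have hge : ∑ _v ∈ F, ENNReal.ofReal (Real.exp (-c)) ≤
      ∑ v ∈ F, carpetBernoulli a' (carpetBlock n ⁻¹' {v}) := by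
    refine Finset.sum_le_sum fun v hv => ?_
    obtain ⟨ω, hω, rfl⟩ := (Set.Finite.mem_toFinset _).1 hv
    rw [carpetBernoulli_block_eq (a := a') h0 h1]
    exact ENNReal.ofReal_le_ofReal (Real.exp_le_exp.2 (hA ω hω))
  have h := hge.trans hsum
  rw [Finset.sum_const, nsmul_eq_mul, ← ENNReal.ofReal_natCast,
    ← ENNReal.ofReal_mul (by positivity), ← ENNReal.ofReal_one,
    ENNReal.ofReal_le_ofReal_iff zero_le_one, Real.exp_neg, ← div_eq_mul_inv,
    div_le_one (Real.exp_pos _)] at h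
  exact h

lemma ae_mem_carpetLevel (a : unitInterval) :
    ∀ᵐ ω ∂carpetBernoulli a, ω ∈ carpetLevel phiEx1 a := by
  let g : CarpetDigit → ℝ := fun d => if d = digitOne then 1 else 0
  have hg : Measurable g := Measurable.of_discrete
  have hmp : ∀ i : ℕ, MeasurePreserving (Function.eval i) (carpetBernoulli a) (digitMeasure a) :=
    fun i => measurePreserving_eval_infinitePi (fun _ : ℕ => digitMeasure a) i
  have hind : ProbabilityTheory.iIndepFun (fun (i : ℕ) (ω : CarpetSymb) => g (ω i))
      (carpetBernoulli a) :=
    ProbabilityTheory.iIndepFun_infinitePi (X := fun _ : ℕ => g) fun _ => hg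
  have hgint : Integrable g (digitMeasure a) := Integrable.of_finite
  have hlaw := ProbabilityTheory.strong_law_ae_real (fun (i : ℕ) (ω : CarpetSymb) => g (ω i))
    ((hmp 0).integrable_comp_of_integrable hgint) (fun i j hij => hind.indepFun hij)
    (fun i => by
      refine ⟨(hg.comp (hmp i).measurable).aemeasurable, (hg.comp (hmp 0).measurable).aemeasurable, ?_⟩
      have key : ∀ j : ℕ, (carpetBernoulli a).map (fun ω => g (ω j)) = (digitMeasure a).map g := by
        intro j
        rw [← (hmp j).map_eq, Measure.map_map hg (hmp j).measurable]
        rfl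
      rw [key i, key 0])
  have hint : ∫ ω, g (ω 0) ∂carpetBernoulli a = a := by
    have h1 : ∫ ω, g (ω 0) ∂carpetBernoulli a = ∫ d, g d ∂digitMeasure a := by
      rw [← (hmp 0).map_eq, integral_map (hmp 0).measurable.aemeasurable
        hg.aestronglyMeasurable]
    rw [h1, integral_fintype hgint]
    have hd : ∀ d, (digitMeasure a).real {d} • g d = if d = digitOne then (a : ℝ) else 0 := by
      intro d
      rw [measureReal_def, digitMeasure_singleton]
      by_cases h : d = digitOne
      · simp [g, h, a.2.1]
      · simp [g, h]
    simp only [hd, Finset.sum_ite_eq', Finset.mem_univ, if_true]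
  rw [hint] at hlaw
  filter_upwards [hlaw] with ω hω
  rw [mem_carpetLevel_iff]
  exact hω

end Weights

section UpperBounds

lemma ediam_image_carpetCoding_le {n : ℕ} {v : Fin n → CarpetDigit} {A : Set CarpetSymb}
    (hA : ∀ ω ∈ A, carpetBlock n ω = v) :
    ediam (carpetCoding '' A) ≤ ENNReal.ofReal (3 * (2 ^ n)⁻¹) := by
  refine ediam_le ?_
  rintro _ ⟨ω, hω, rfl⟩ _ ⟨η, hη, rfl⟩
  rw [edist_dist]
  exact ENNReal.ofReal_le_ofReal (dist_carpetCoding_le ((hA ω hω).trans (hA η hη).symm))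

lemma dimH_image_le_of_frequently {a t : ℝ} (h0 : 0 < a) (h1 : a < 1) (ht : 0 ≤ t)
    {A : Set CarpetSymb}
    (hA : ∀ ω ∈ A, ∃ᶠ n : ℕ in atTop, -(n * (t * Real.log 2)) ≤ logWeight a n ω) :
    dimH (carpetCoding '' A) ≤ ENNReal.ofReal t := by
  refine le_of_forall_gt_imp_ge_of_dense fun c hc => ?_
  rcases eq_or_ne c ⊤ with rfl | hctop
  · exact le_top
  lift c to ℝ≥0 using hctop
  have htc : t < c := by
    rw [ENNReal.ofReal, ENNReal.coe_lt_coe] at hc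
    exact (Real.le_coe_toNNReal _).trans_lt (by exact_mod_cast hc)
  have hc0 : (0 : ℝ) < c := ht.trans_lt htc
  refine dimH_le_of_hausdorffMeasure_ne_top ?_
  set B : ℕ → Set CarpetSymb := fun n => {ω ∈ A | -(n * (t * Real.log 2)) ≤ logWeight a n ω}
    with hB
  have hlim : Tendsto (fun N : ℕ => ENNReal.ofReal (3 * ((2 : ℝ) ^ N)⁻¹)) atTop (𝓝 0) := by
    have h : Tendsto (fun N : ℕ => 3 * ((2 : ℝ) ^ N)⁻¹) atTop (𝓝 (3 * 0)) := by
      have := (tendsto_pow_atTop_nhds_zero_of_lt_one (r := (2 : ℝ)⁻¹) (by norm_num)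
        (by norm_num)).const_mul 3
      simpa only [inv_pow] using this
    have := (ENNReal.continuous_ofReal.tendsto _).comp h
    rwa [mul_zero, ENNReal.ofReal_zero] at this
  have hdiam : ∀ (N : ℕ) (i : Σ m : ℕ, (Fin (N + m) → CarpetDigit)),
      ediam (carpetCoding '' (B (N + i.1) ∩ carpetBlock (N + i.1) ⁻¹' {i.2})) ≤
        ENNReal.ofReal (3 * (2 ^ (N + i.1))⁻¹) :=
    fun N i => ediam_image_carpetCoding_le (v := i.2) fun ω hω => hω.2
  have hH := Measure.hausdorffMeasure_le_liminf_tsum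
    (ι := fun N : ℕ => Σ m : ℕ, (Fin (N + m) → CarpetDigit)) (c : ℝ) (carpetCoding '' A)
    (fun N : ℕ => ENNReal.ofReal (3 * ((2 : ℝ) ^ N)⁻¹)) hlim
    (fun N i => carpetCoding '' (B (N + i.1) ∩ carpetBlock (N + i.1) ⁻¹' {i.2}))
    (Eventually.of_forall fun N i => (hdiam N i).trans (ENNReal.ofReal_le_ofReal (by
      gcongr
      · norm_num
      · omega)))
    (Eventually.of_forall fun N => by
      rintro _ ⟨ω, hω, rfl⟩
      obtain ⟨n, hn, hw⟩ := (frequently_atTop.1 (hA ω hω)) N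
      obtain ⟨m, rfl⟩ := Nat.exists_eq_add_of_le hn
      exact mem_iUnion.2 ⟨⟨m, carpetBlock _ ω⟩, ω, ⟨⟨hω, hw⟩, rfl⟩, rfl⟩)
  set ρ : ℝ := 2 ^ (t - c) with hρ
  have hρ0 : 0 < ρ := by positivity
  have hρ1 : ρ < 1 := Real.rpow_lt_one_of_one_lt_of_neg (by norm_num) (by linarith)
  have hlevel : ∀ n : ℕ, ∑ v, ediam (carpetCoding '' (B n ∩ carpetBlock n ⁻¹' {v})) ^ (c : ℝ) ≤
      ENNReal.ofReal (3 ^ (c : ℝ) * ρ ^ n) := by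
    intro n
    classical
    have hcard := ncard_block_image_le h0 h1 (n := n) (A := B n)
      (c := n * (t * Real.log 2)) fun ω hω => hω.2
    rw [Set.ncard_eq_toFinset_card _ (Set.toFinite _)] at hcard
    set F := (Set.toFinite (carpetBlock n '' B n)).toFinset with hF
    calc ∑ v, ediam (carpetCoding '' (B n ∩ carpetBlock n ⁻¹' {v})) ^ (c : ℝ)
        ≤ ∑ v, if v ∈ F then ENNReal.ofReal ((3 * (2 ^ n)⁻¹) ^ (c : ℝ)) else 0 := by
          refine Finset.sum_le_sum fun v _ => ?_
          split_ifs with hv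
          · rw [← ENNReal.ofReal_rpow_of_nonneg (by positivity) hc0.le]
            exact ENNReal.rpow_le_rpow
              (ediam_image_carpetCoding_le (v := v) fun ω hω => hω.2) hc0.le
          · have : B n ∩ carpetBlock n ⁻¹' {v} = ∅ := by
              rw [eq_empty_iff_forall_notMem]
              intro ω hω
              exact hv ((Set.Finite.mem_toFinset _).2 ⟨ω, hω.1, hω.2⟩)
            rw [this, image_empty, ediam_empty, ENNReal.zero_rpow_of_pos hc0]
      _ = ENNReal.ofReal (F.card * (3 * (2 ^ n)⁻¹) ^ (c : ℝ)) := by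
          rw [Finset.sum_ite_mem, Finset.univ_inter, Finset.sum_const, nsmul_eq_mul,
            ENNReal.ofReal_mul (by positivity), ENNReal.ofReal_natCast]
      _ ≤ ENNReal.ofReal (3 ^ (c : ℝ) * ρ ^ n) := by
          refine ENNReal.ofReal_le_ofReal ?_
          calc (F.card : ℝ) * (3 * (2 ^ n)⁻¹) ^ (c : ℝ)
              ≤ Real.exp (n * (t * Real.log 2)) * (3 * (2 ^ n)⁻¹) ^ (c : ℝ) := by gcongr
            _ = 3 ^ (c : ℝ) * ρ ^ n := by
                rw [Real.mul_rpow (by norm_num) (by positivity), mul_left_comm]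
                congr 1
                rw [← Real.rpow_natCast 2 n, ← Real.rpow_neg (by norm_num), hρ,
                  ← Real.rpow_natCast, ← Real.rpow_mul (by norm_num),
                  ← Real.rpow_mul (by norm_num), Real.rpow_def_of_pos (by norm_num),
                  Real.rpow_def_of_pos (by norm_num), ← Real.exp_add]
                congr 1
                ring
  have hgeo : Summable fun m : ℕ => 3 ^ (c : ℝ) * ρ ^ m :=
    (summable_geometric_of_lt_one hρ0.le hρ1).mul_left _
  refine ne_top_of_le_ne_top (b := ENNReal.ofReal (∑' m : ℕ, 3 ^ (c : ℝ) * ρ ^ m))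
    ENNReal.ofReal_ne_top (hH.trans ?_)
  refine liminf_le_of_frequently_le' (Eventually.frequently (Eventually.of_forall fun N => ?_))
  rw [ENNReal.tsum_sigma', ENNReal.ofReal_tsum_of_nonneg (fun m => by positivity) hgeo]
  refine ENNReal.tsum_le_tsum fun m => ?_
  rw [tsum_fintype]
  refine (hlevel (N + m)).trans (ENNReal.ofReal_le_ofReal ?_)
  exact mul_le_mul_of_nonneg_left (pow_le_pow_of_le_one hρ0.le hρ1.le (by omega)) (by positivity)

lemma coverN_image_carpetCoding_le {n : ℕ} {r : ℝ} (hr : 3 * ((2 : ℝ) ^ n)⁻¹ < r)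
    (A : Set CarpetSymb) : coverN (carpetCoding '' A) r ≤ (carpetBlock n '' A).ncard := by
  classical
  rw [Set.ncard_eq_toFinset_card _ (Set.toFinite _)]
  set F := (Set.toFinite (carpetBlock n '' A)).toFinset with hF
  have : Nonempty CarpetSymb := ⟨fun _ => digitZero⟩
  have key : ∀ v ∈ F, ∃ ω, carpetBlock n ω = v := fun v hv => by
    obtain ⟨ω, -, h⟩ := (Set.Finite.mem_toFinset _).1 hv
    exact ⟨ω, h⟩
  choose! w hw using key
  refine (coverN_le_card (F.image fun v => carpetCoding (w v)) ?_).trans Finset.card_image_le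
  rintro _ ⟨ω, hω, rfl⟩
  have hmem : carpetBlock n ω ∈ F := (Set.Finite.mem_toFinset _).2 ⟨ω, hω, rfl⟩
  exact mem_iUnion₂.2 ⟨_, Finset.mem_image_of_mem _ hmem,
    (dist_carpetCoding_le (hw _ hmem).symm).trans_lt hr⟩

lemma upperBoxDim_image_le {A : Set CarpetSymb} {t : ℝ} (ht : 0 ≤ t) {N : ℕ}
    (hA : ∀ n ≥ N, ((carpetBlock n '' A).ncard : ℝ) ≤ Real.exp (n * (t * Real.log 2))) :
    upperBoxDim (carpetCoding '' A) ≤ t := by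
  refine le_of_forall_pos_le_add fun ε hε => upperBoxDim_le_of_eventually ?_
  have hlog : Tendsto (fun r : ℝ => Real.log r⁻¹) (𝓝[>] 0) atTop :=
    Real.tendsto_log_atTop.comp tendsto_inv_nhdsGT_zero
  filter_upwards [eventually_small_radius, hlog.eventually_ge_atTop (t * Real.log 6 / ε),
    Ioo_mem_nhdsGT (show (0 : ℝ) < 3 / 2 ^ N by positivity)] with r ⟨h0, h1, h2⟩ h3 h4
  rw [div_le_iff₀ h2]
  rw [div_le_iff₀ hε] at h3
  obtain ⟨n, hn1, hn2⟩ := exists_nat_pow_near (x := 3 / r) (y := (2 : ℝ))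
    (by rw [le_div_iff₀ h0]; linarith) (by norm_num)
  have hN : N ≤ n + 1 := by
    have h5 : (2 : ℝ) ^ N < 2 ^ (n + 1) := by
      refine lt_trans ?_ hn2
      rw [lt_div_iff₀ h0, mul_comm]
      exact (lt_div_iff₀ (by positivity)).1 h4.2
    exact ((pow_lt_pow_iff_right₀ (by norm_num)).1 h5).le
  have hr : 3 * ((2 : ℝ) ^ (n + 1))⁻¹ < r := by
    rw [← div_eq_mul_inv, div_lt_iff₀ (by positivity)]
    rwa [div_lt_iff₀ h0, mul_comm] at hn2
  have hnlog : ((n + 1 : ℕ) : ℝ) * Real.log 2 ≤ Real.log 6 + Real.log r⁻¹ := by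
    rw [← Real.log_pow, ← Real.log_mul (by norm_num) (by positivity)]
    refine Real.log_le_log (by positivity) ?_
    rw [pow_succ, ← div_eq_mul_inv]
    calc (2 : ℝ) ^ n * 2 ≤ 3 / r * 2 := by gcongr
      _ = 6 / r := by ring
  rcases Nat.eq_zero_or_pos (coverN (carpetCoding '' A) r) with h | h
  · rw [h, Nat.cast_zero, Real.log_zero]
    positivity
  have hle : (coverN (carpetCoding '' A) r : ℝ) ≤ Real.exp ((n + 1 : ℕ) * (t * Real.log 2)) :=
    (Nat.cast_le.2 (coverN_image_carpetCoding_le hr A)).trans (hA (n + 1) hN)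
  have hlogle := Real.log_le_log (by exact_mod_cast h) hle
  rw [Real.log_exp] at hlogle
  nlinarith [mul_le_mul_of_nonneg_left hnlog ht]

lemma specEx1_mul_log_two (α : ℝ) : specEx1 α * Real.log 2 =
    -(α * Real.log α + (1 - α) * Real.log (1 - α) -
      (carpetRatio - α * carpetRatio) * Real.log 2) := by
  have h : Real.log 2 ≠ 0 := (Real.log_pos (by norm_num)).ne'
  rw [specEx1, Real.negMulLog, Real.negMulLog, carpetRatio, add_mul, div_mul_cancel₀ _ h]
  ring

lemma specEx1_nonneg {α : ℝ} (hα : α ∈ Icc (0 : ℝ) 1) : 0 ≤ specEx1 α := by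
  have h2 : 0 < Real.log 2 := Real.log_pos (by norm_num)
  have h3 : 0 < Real.log 3 := Real.log_pos (by norm_num)
  have := Real.negMulLog_nonneg hα.1 hα.2
  have := Real.negMulLog_nonneg (x := 1 - α) (by linarith [hα.2]) (by linarith [hα.1])
  have : 0 ≤ 1 - α := by linarith [hα.2]
  unfold specEx1
  positivity

/-- Cross entropies relative to nondegenerate weights approximate the entropy. -/
lemma exists_crossEntropy_gt {α : ℝ} (hα : α ∈ Icc (0 : ℝ) 1) {δ : ℝ} (hδ : 0 < δ) :
    ∃ a : ℝ, 0 < a ∧ a < 1 ∧ α * Real.log α + (1 - α) * Real.log (1 - α) - δ <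
      α * Real.log a + (1 - α) * Real.log (1 - a) := by
  have he : Real.exp (-(δ / 2)) < 1 := by
    rw [Real.exp_lt_one_iff]
    linarith
  have he0 := Real.exp_pos (-(δ / 2))
  rcases hα.1.eq_or_lt with rfl | h0
  · refine ⟨1 - Real.exp (-(δ / 2)), by linarith, by linarith, ?_⟩
    simp only [sub_sub_cancel, Real.log_exp]
    simp
    linarith
  rcases hα.2.eq_or_lt with rfl | h1
  · refine ⟨Real.exp (-(δ / 2)), he0, he, ?_⟩
    simp only [Real.log_exp]
    simp
    linarith
  · exact ⟨α, h0, h1, by linarith⟩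

lemma packingDim_level_le {α : ℝ} (hα : α ∈ Icc (0 : ℝ) 1) :
    packingDim (carpetCoding '' carpetLevel phiEx1 α) ≤ specEx1 α := by
  have h2 : 0 < Real.log 2 := Real.log_pos (by norm_num)
  refine le_of_forall_pos_le_add fun ε hε => ?_
  obtain ⟨a, ha0, ha1, ha⟩ := exists_crossEntropy_gt hα (mul_pos hε h2)
  set t := specEx1 α + ε with ht
  have ht0 : 0 ≤ t := by linarith [specEx1_nonneg hα]
  have hspec := specEx1_mul_log_two α
  have htl : -(t * Real.log 2) < α * Real.log a + (1 - α) * Real.log (1 - a) -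
      (carpetRatio - α * carpetRatio) * Real.log 2 := by
    rw [ht, add_mul, hspec]
    linarith
  refine packingDim_le_of_cover (fun N : ℕ => carpetCoding '' {ω |
    ∀ n ≥ N, -(n * (t * Real.log 2)) ≤ logWeight a n ω}) ?_ fun N => ?_
  · rw [← image_iUnion]
    refine image_mono fun ω hω => ?_
    obtain ⟨N, hN⟩ := eventually_atTop.1
      (((tendsto_logWeight_div hω a).eventually_const_lt htl).and (eventually_gt_atTop 0))
    refine mem_iUnion.2 ⟨N, fun n hn => ?_⟩
    obtain ⟨h, hn0⟩ := hN n hn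
    rw [lt_div_iff₀ (by exact_mod_cast hn0)] at h
    linarith
  · exact upperBoxDim_image_le ht0 (N := N) fun n hn =>
      ncard_block_image_le ha0 ha1 fun ω hω => hω n hn

end UpperBounds

section LowerBounds

lemma measure_inter_preimage_le {μ : Measure CarpetSymb} {A : Set CarpetSymb} {n : ℕ} {c : ℝ≥0∞}
    (hA : ∀ ω ∈ A, μ (carpetBlock n ⁻¹' {carpetBlock n ω}) ≤ c)
    {U : Set (AddCircle (1 : ℝ) × AddCircle (1 : ℝ))}
    (hU : ∀ u ∈ U, ∀ v ∈ U, dist u v ≤ ((2 : ℝ) ^ n)⁻¹) :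
    μ (carpetCoding ⁻¹' U ∩ A) ≤ 225 * c := by
  classical
  set F := (Set.toFinite (carpetBlock n '' (carpetCoding ⁻¹' U ∩ A))).toFinset with hF
  have hcard : F.card ≤ 225 := by
    rw [← Set.ncard_eq_toFinset_card]
    exact (Set.ncard_le_ncard (image_mono inter_subset_left) (Set.toFinite _)).trans
      (ncard_carpetBlock_le hU)
  calc μ (carpetCoding ⁻¹' U ∩ A) ≤ μ (⋃ v ∈ F, carpetBlock n ⁻¹' {v}) :=
        measure_mono fun ω hω => mem_iUnion₂.2
          ⟨_, (Set.Finite.mem_toFinset _).2 ⟨ω, hω, rfl⟩, rfl⟩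
    _ ≤ ∑ v ∈ F, μ (carpetBlock n ⁻¹' {v}) := measure_biUnion_finset_le _ _
    _ ≤ ∑ _v ∈ F, c := Finset.sum_le_sum fun v hv => by
        obtain ⟨ω, hω, rfl⟩ := (Set.Finite.mem_toFinset _).1 hv
        exact hA ω hω.2
    _ ≤ 225 * c := by
        rw [Finset.sum_const, nsmul_eq_mul]
        gcongr
        exact_mod_cast hcard

/-- The mass distribution principle for approximate squares. -/
lemma le_dimH_image {μ : Measure CarpetSymb} {A : Set CarpetSymb} (hA0 : μ A ≠ 0) {t : ℝ≥0}
    (ht : 0 < t) {N : ℕ} (hA : ∀ n ≥ N, ∀ ω ∈ A,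
      μ (carpetBlock n ⁻¹' {carpetBlock n ω}) ≤ ENNReal.ofReal ((2 ^ n)⁻¹ ^ (t : ℝ))) :
    (t : ℝ≥0∞) ≤ dimH (carpetCoding '' A) := by
  have ht' : (0 : ℝ) < t := ht
  have hmeas := continuous_carpetCoding.measurable
  set ν := (μ.restrict A).map carpetCoding with hν
  have hball : ∀ n ≥ N, ∀ U : Set (AddCircle (1 : ℝ) × AddCircle (1 : ℝ)),
      ediam U ≤ ENNReal.ofReal ((2 ^ n)⁻¹) →
        ν U ≤ 225 * ENNReal.ofReal ((2 ^ n)⁻¹ ^ (t : ℝ)) := by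
    intro n hn U hU
    calc ν U ≤ ν (closure U) := measure_mono subset_closure
      _ = μ (carpetCoding ⁻¹' closure U ∩ A) := by
          rw [hν, Measure.map_apply hmeas isClosed_closure.measurableSet,
            Measure.restrict_apply (hmeas isClosed_closure.measurableSet)]
      _ ≤ _ := measure_inter_preimage_le (hA n hn) fun u hu v hv => by
          have h := (edist_le_ediam_of_mem hu hv).trans_eq (ediam_closure U)
          rw [← ENNReal.ofReal_le_ofReal_iff (by positivity), ← edist_dist]
          exact h.trans hU
  set C : ℝ≥0∞ := 225 * ENNReal.ofReal (2 ^ (t : ℝ)) with hC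
  have hC0 : C ≠ 0 := by
    rw [hC]
    refine mul_ne_zero (by norm_num) ?_
    rw [Ne, ENNReal.ofReal_eq_zero, not_le]
    positivity
  have hCtop : C ≠ ⊤ := ENNReal.mul_ne_top (by norm_num) ENNReal.ofReal_ne_top
  have hbound : ∀ U : Set (AddCircle (1 : ℝ) × AddCircle (1 : ℝ)),
      ediam U ≤ ENNReal.ofReal ((2 ^ N)⁻¹) → ν U ≤ C * ediam U ^ (t : ℝ) := by
    intro U hU
    have hUtop : ediam U ≠ ⊤ := ne_top_of_le_ne_top ENNReal.ofReal_ne_top hU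
    obtain ⟨d, hd0, hd⟩ : ∃ d : ℝ, 0 ≤ d ∧ ediam U = ENNReal.ofReal d :=
      ⟨_, ENNReal.toReal_nonneg, (ENNReal.ofReal_toReal hUtop).symm⟩
    rcases hd0.eq_or_lt with rfl | hdpos
    · rw [ENNReal.ofReal_zero] at hd
      have hlim : Tendsto (fun n : ℕ => 225 * ENNReal.ofReal (((2 : ℝ) ^ n)⁻¹ ^ (t : ℝ))) atTop
          (𝓝 (225 * ENNReal.ofReal (0 ^ (t : ℝ)))) := by
        refine ENNReal.Tendsto.const_mul ?_ (Or.inr (by norm_num))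
        refine (ENNReal.continuous_ofReal.tendsto _).comp ?_
        have := tendsto_pow_atTop_nhds_zero_of_lt_one (r := (2 : ℝ)⁻¹) (by norm_num)
          (by norm_num)
        simp only [inv_pow] at this
        exact this.rpow_const (Or.inr ht'.le)
      rw [Real.zero_rpow ht'.ne', ENNReal.ofReal_zero, mul_zero] at hlim
      have : ν U ≤ 0 := ge_of_tendsto hlim (eventually_atTop.2
        ⟨N, fun n hn => hball n hn U (by rw [hd]; exact zero_le)⟩)
      exact this.trans zero_le
    · rw [hd, ENNReal.ofReal_le_ofReal_iff (by positivity)] at hU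
      obtain ⟨n, hn1, hn2⟩ := exists_nat_pow_near (x := d⁻¹) (y := (2 : ℝ))
        (by
          rw [one_le_inv₀ hdpos]
          exact hU.trans (inv_le_one_of_one_le₀ (one_le_pow₀ (by norm_num)))) (by norm_num)
      have hN : N ≤ n := by
        have h5 : (2 : ℝ) ^ N < 2 ^ (n + 1) :=
          ((le_inv_comm₀ hdpos (by positivity)).1 hU).trans_lt hn2
        exact Nat.lt_succ_iff.1 ((pow_lt_pow_iff_right₀ (by norm_num)).1 h5)
      refine (hball n hN U ?_).trans ?_
      · rw [hd]
        exact ENNReal.ofReal_le_ofReal ((le_inv_comm₀ (by positivity) hdpos).1 hn1)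
      · rw [hC, hd, mul_assoc, ENNReal.ofReal_rpow_of_nonneg hd0 ht'.le,
          ← ENNReal.ofReal_mul (by positivity), ← Real.mul_rpow (by norm_num) hd0]
        gcongr
        rw [pow_succ] at hn2
        rw [inv_le_comm₀ (by positivity) (by positivity), mul_inv]
        linarith
  have hle : C⁻¹ • ν ≤ μH[(t : ℝ)] := by
    refine Measure.le_hausdorffMeasure (t : ℝ) _ (ENNReal.ofReal ((2 ^ N)⁻¹)) ?_ fun U hU => ?_
    · rw [ENNReal.ofReal_pos]
      positivity
    · rw [Measure.smul_apply, smul_eq_mul, mul_comm, ← div_eq_mul_inv]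
      exact ENNReal.div_le_of_le_mul (by rw [mul_comm]; exact hbound U hU)
  refine le_dimH_of_hausdorffMeasure_ne_zero fun h0 => hA0 ?_
  have h1 := hle (carpetCoding '' A)
  rw [h0, Measure.smul_apply, smul_eq_mul, nonpos_iff_eq_zero, mul_eq_zero] at h1
  have h2 := h1.resolve_left (ENNReal.inv_ne_zero.2 hCtop)
  refine le_antisymm ?_ zero_le
  calc μ A = μ.restrict A A := (Measure.restrict_apply_self _ _).symm
    _ ≤ μ.restrict A (carpetCoding ⁻¹' (carpetCoding '' A)) :=
        measure_mono (subset_preimage_image _ _)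
    _ ≤ ν (carpetCoding '' A) := Measure.le_map_apply hmeas.aemeasurable _
    _ = 0 := h2

lemma specEx1_le_dimH_level {α : ℝ} (hα : α ∈ Icc (0 : ℝ) 1) :
    ENNReal.ofReal (specEx1 α) ≤ dimH (carpetCoding '' carpetLevel phiEx1 α) := by
  have h2 : 0 < Real.log 2 := Real.log_pos (by norm_num)
  refine ENNReal.le_of_forall_nnreal_lt fun t ht => ?_
  rcases eq_or_ne t 0 with rfl | ht0
  · exact zero_le
  have htspec : (t : ℝ) < specEx1 α := by
    rw [ENNReal.ofReal, ENNReal.coe_lt_coe] at ht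
    exact (Real.lt_toNNReal_iff_coe_lt).1 ht
  set a : unitInterval := ⟨α, hα⟩ with ha
  set A : ℕ → Set CarpetSymb := fun N => {ω ∈ carpetLevel phiEx1 α |
    ∀ n ≥ N, logWeight α n ω ≤ -(n * (t * Real.log 2))} with hA
  have hspec := specEx1_mul_log_two α
  have hsub : carpetLevel phiEx1 α ⊆ ⋃ N, A N := fun ω hω => by
    obtain ⟨N, hN⟩ := eventually_atTop.1 (((tendsto_logWeight_div hω α).eventually_lt_const
      (u := -(t * Real.log 2)) (by nlinarith)).and (eventually_gt_atTop 0))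
    refine mem_iUnion.2 ⟨N, hω, fun n hn => ?_⟩
    obtain ⟨h, hn0⟩ := hN n hn
    rw [div_lt_iff₀ (by exact_mod_cast hn0)] at h
    linarith
  obtain ⟨N, hN⟩ : ∃ N, carpetBernoulli a (A N) ≠ 0 := by
    by_contra! h
    have h0 : carpetBernoulli a (⋃ N, A N) = 0 := measure_iUnion_null h
    have h1 : ∀ᵐ ω ∂carpetBernoulli a, False := by
      filter_upwards [ae_mem_carpetLevel a, measure_eq_zero_iff_ae_notMem.1 h0] with ω h2 h3
      exact h3 (hsub h2)
    obtain ⟨ω, hω⟩ := h1.exists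
    exact hω
  refine (le_dimH_image hN (pos_iff_ne_zero.2 ht0) (N := N) fun n hn ω hω => ?_).trans
    (dimH_mono (image_mono fun ω hω => hω.1))
  refine (carpetBernoulli_block_le a n ω).trans (ENNReal.ofReal_le_ofReal ?_)
  rw [← Real.rpow_natCast 2 n, ← Real.rpow_neg (by norm_num), ← Real.rpow_mul (by norm_num),
    Real.rpow_def_of_pos (by norm_num)]
  refine Real.exp_le_exp.2 ((hω.2 n hn).trans_eq ?_)
  ring

end LowerBounds

section CarpetPacking

lemma ncard_image_preimage_le {n : ℕ} {r : ℝ} (hr : 0 < r) (hrn : 2 * r ≤ ((2 : ℝ) ^ n)⁻¹)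
    (C : Set (AddCircle (1 : ℝ) × AddCircle (1 : ℝ))) :
    (carpetBlock n '' (carpetCoding ⁻¹' C)).ncard ≤ 225 * coverN C r := by
  classical
  obtain ⟨t, ht, hC⟩ := exists_finset_coverN C hr
  set F := fun x => (Set.toFinite (carpetBlock n '' (carpetCoding ⁻¹' ball x r))).toFinset with hF
  have hsub : carpetBlock n '' (carpetCoding ⁻¹' C) ⊆ (t.biUnion F : Finset _) := by
    rintro _ ⟨ω, hω, rfl⟩
    obtain ⟨x, hx, hmem⟩ := mem_iUnion₂.1 (hC hω)
    exact Finset.mem_coe.2 (Finset.mem_biUnion.2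
      ⟨x, hx, (Set.Finite.mem_toFinset _).2 ⟨ω, hmem, rfl⟩⟩)
  have h := Set.ncard_le_ncard hsub (Finset.finite_toSet _)
  rw [Set.ncard_coe_finset] at h
  rw [← ht, mul_comm]
  refine h.trans (Finset.card_biUnion_le_card_mul _ _ _ fun x _ => ?_)
  rw [hF, ← Set.ncard_eq_toFinset_card]
  refine ncard_carpetBlock_le fun u hu v hv => ?_
  have h1 := mem_ball.1 hu
  have h2 := mem_ball'.1 hv
  linarith [dist_triangle u x v]

/-- A set of symbols which is dense in a cylinder meets many approximate squares. -/
lemma le_ncard_block_image {A : Set CarpetSymb} {w : CarpetSymb} {m n : ℕ}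
    (hA : PiNat.cylinder w m ⊆ closure A) (hm : m ≤ colLen n) :
    3 ^ colLen n * 2 ^ (n - colLen n) ≤ 3 ^ m * (carpetBlock n '' A).ncard := by
  classical
  set S : Fin n → Finset CarpetDigit := fun k =>
    if (k : ℕ) < m then {w k} else if (k : ℕ) < colLen n then Finset.univ
      else {digitZero, digitOne} with hS
  have hsub : ((Fintype.piFinset S : Finset _) : Set (Fin n → CarpetDigit)) ⊆
      carpetBlock n '' A := by
    intro g hg
    rw [Finset.mem_coe, Fintype.mem_piFinset] at hg
    set η : CarpetSymb := fun k => if hk : k < n then g ⟨k, hk⟩ else w k with hη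
    have hηw : η ∈ PiNat.cylinder w m := by
      rw [PiNat.mem_cylinder_iff]
      intro k hk
      simp only [hη]
      split_ifs with hkn
      · simpa [hS, hk] using hg ⟨k, hkn⟩
      · rfl
    obtain ⟨ω, hωη, hωA⟩ := mem_closure_iff.1 (hA hηw) _ (PiNat.isOpen_cylinder _ η n)
      (PiNat.self_mem_cylinder η n)
    refine ⟨ω, hωA, funext fun k => ?_⟩
    have hωk : ω k = g k := by
      rw [PiNat.mem_cylinder_iff.1 hωη k k.2]
      simp [hη]
    rw [carpetBlock, hωk]
    split_ifs with hk
    · rfl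
    · have := hg k
      rw [hS] at this
      simp only [hk, show ¬ (k : ℕ) < m by omega, if_false, Finset.mem_insert,
        Finset.mem_singleton] at this
      rcases this with h | h <;> simp [h, rowRep, digitOne_ne_zero.symm]
  have hcard : (Fintype.piFinset S).card ≤ (carpetBlock n '' A).ncard := by
    rw [← Set.ncard_coe_finset]
    exact Set.ncard_le_ncard hsub (Set.toFinite _)
  have hS3 : ∀ k : Fin n, (if (k : ℕ) < colLen n then 3 else 2) ≤
      (if (k : ℕ) < m then 3 else 1) * (S k).card := by
    intro k
    have h3 : (Finset.univ : Finset CarpetDigit).card = 3 := rfl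
    have h2 : ({digitZero, digitOne} : Finset CarpetDigit).card = 2 :=
      Finset.card_pair digitOne_ne_zero.symm
    simp only [hS]
    split_ifs <;> simp only [Finset.card_singleton, h2, h3] <;> omega
  have hprod : ∀ l ≤ n, ∀ a b : ℕ, (∏ k : Fin n, if (k : ℕ) < l then a else b) =
      a ^ l * b ^ (n - l) := by
    intro l hl a b
    rw [Fin.prod_univ_eq_prod_range (fun k => if k < l then a else b) n, Finset.prod_ite,
      Finset.prod_const, Finset.prod_const]
    congr 2
    · rw [show (Finset.range n).filter (fun k => k < l) = Finset.range l by
        ext; simp; omega, Finset.card_range]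
    · rw [show (Finset.range n).filter (fun k => ¬ k < l) = Finset.Ico l n by
        ext; simp; omega, Nat.card_Ico]
  calc 3 ^ colLen n * 2 ^ (n - colLen n)
      = ∏ k : Fin n, if (k : ℕ) < colLen n then 3 else 2 := (hprod _ (colLen_le n) _ _).symm
    _ ≤ ∏ k : Fin n, (if (k : ℕ) < m then 3 else 1) * (S k).card :=
        Finset.prod_le_prod' fun k _ => hS3 k
    _ = 3 ^ m * (Fintype.piFinset S).card := by
        rw [Finset.prod_mul_distrib, hprod m (hm.trans (colLen_le n)), Fintype.card_piFinset,
          one_pow, mul_one]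
    _ ≤ _ := Nat.mul_le_mul_left _ hcard

lemma le_upperBoxDim_of_dense {C : Set (AddCircle (1 : ℝ) × AddCircle (1 : ℝ))} {w : CarpetSymb}
    {m : ℕ} (hC : PiNat.cylinder w m ⊆ closure (carpetCoding ⁻¹' C)) :
    2 - carpetRatio ≤ upperBoxDim C := by
  have h2 : 0 < Real.log 2 := Real.log_pos (by norm_num)
  have h23 : Real.log 2 < Real.log 3 := Real.log_lt_log (by norm_num) (by norm_num)
  refine le_of_forall_pos_sub_le fun ε hε => ?_
  have hr : Tendsto (fun n : ℕ => ((2 : ℝ) ^ (n + 1))⁻¹) atTop (𝓝[>] 0) := by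
    refine tendsto_inv_atTop_nhdsGT_zero.comp ?_
    exact (tendsto_pow_atTop_atTop_of_one_lt (by norm_num)).comp (tendsto_add_atTop_nat 1)
  refine le_upperBoxDim_of_frequently (hr.frequently (Eventually.frequently ?_))
  set K := m * Real.log 3 + Real.log 225 + Real.log 3 + 2 * Real.log 2 with hK
  filter_upwards [tendsto_colLen_atTop.eventually_ge_atTop m,
    tendsto_natCast_atTop_atTop.eventually_ge_atTop (K / (ε * Real.log 2))] with n hn hnK
  rw [div_le_iff₀ (by positivity)] at hnK
  have hcount := (le_ncard_block_image hC hn).trans (Nat.mul_le_mul_left _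
    (ncard_image_preimage_le (n := n) (r := ((2 : ℝ) ^ (n + 1))⁻¹) (by positivity)
      (le_of_eq (by rw [pow_succ]; field_simp)) C))
  set N := coverN C ((2 : ℝ) ^ (n + 1))⁻¹ with hN
  have hN0 : 0 < N := by
    rcases Nat.eq_zero_or_pos N with h | h
    · rw [h] at hcount
      have : 0 < 3 ^ colLen n * 2 ^ (n - colLen n) := by positivity
      omega
    · exact h
  have hNR : (0 : ℝ) < N := by exact_mod_cast hN0
  have hlog : Real.log (3 ^ colLen n * 2 ^ (n - colLen n)) ≤ Real.log (3 ^ m * (225 * N)) :=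
    Real.log_le_log (by positivity) (by exact_mod_cast hcount)
  rw [Real.log_mul (by positivity) (by positivity), Real.log_mul (by positivity) (by positivity),
    Real.log_mul (by positivity) (by positivity), Real.log_pow, Real.log_pow, Real.log_pow,
    Nat.cast_sub (colLen_le n)] at hlog
  rw [inv_inv, Real.log_pow, le_div_iff₀ (by positivity)]
  push_cast
  have hθ := carpetRatio_mul_log_three
  have hl := mul_lt_colLen_add_one n
  have h5 : (carpetRatio * n - 1) * (Real.log 3 - Real.log 2) ≤
      colLen n * (Real.log 3 - Real.log 2) :=
    mul_le_mul_of_nonneg_right (by linarith) (by linarith)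
  have h6 : (carpetRatio * n) * Real.log 3 = n * Real.log 2 := by
    rw [← hθ]
    ring
  have h7 : 0 < carpetRatio * Real.log 2 := mul_pos carpetRatio_pos h2
  have h8 : 0 < ε * Real.log 2 := mul_pos hε h2
  nlinarith

lemma le_packingDim_carpet : 2 - carpetRatio ≤ packingDim carpet := by
  refine le_packingDim_of_forall_cover fun C hC => ?_
  have hcov : ⋃ n, closure (carpetCoding ⁻¹' C n) = univ := by
    refine eq_univ_of_forall fun ω => ?_
    obtain ⟨n, hn⟩ := mem_iUnion.1 (hC (mem_range_self ω))
    exact mem_iUnion.2 ⟨n, subset_closure hn⟩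
  have : Nonempty CarpetSymb := ⟨fun _ => digitZero⟩
  obtain ⟨n, ω, hω⟩ := nonempty_interior_of_iUnion_of_closed (fun _ => isClosed_closure) hcov
  obtain ⟨_, ⟨w, m, rfl⟩, -, hsub⟩ :=
    (PiNat.isTopologicalBasis_cylinders fun _ : ℕ => CarpetDigit).exists_subset_of_mem_open hω
      isOpen_interior
  exact ⟨n, le_upperBoxDim_of_dense (hsub.trans interior_subset)⟩

end CarpetPacking

section CarpetHausdorff

lemma colLen_ceil (n : ℕ) : colLen ⌈n / carpetRatio⌉₊ = n := by
  have h0 := carpetRatio_pos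
  have h1 : (n : ℝ) / carpetRatio ≤ ⌈n / carpetRatio⌉₊ := Nat.le_ceil _
  have h2 : (⌈n / carpetRatio⌉₊ : ℝ) < n / carpetRatio + 1 := Nat.ceil_lt_add_one (by positivity)
  rw [div_le_iff₀ h0] at h1
  rw [← sub_lt_iff_lt_add, lt_div_iff₀ h0] at h2
  rw [colLen, Nat.floor_eq_iff (by positivity)]
  constructor <;> nlinarith [carpetRatio_lt_one]

/-- Along some subsequence, a bounded frequency does not drop between scales `colLen n`
and `n`. -/
lemma frequently_le_sub_colLen {z : ℕ → ℝ} (hz0 : ∀ n, 0 ≤ z n) (hz : ∀ n, z n ≤ n) {ε : ℝ}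
    (hε : 0 < ε) : ∃ᶠ n : ℕ in atTop, -(ε * n) ≤ carpetRatio * z n - z (colLen n) := by
  have h0 := carpetRatio_pos
  intro hev
  obtain ⟨N, hN⟩ := eventually_atTop.1 hev
  have hgrow : ∀ j : ℕ, ∀ n ≥ N, j * (ε * n) ≤ z n := by
    intro j
    induction j with
    | zero => intro n _; simpa using hz0 n
    | succ j ih =>
      intro n hn
      set n' := ⌈n / carpetRatio⌉₊ with hn'
      have h1 : (n : ℝ) / carpetRatio ≤ n' := Nat.le_ceil _
      rw [div_le_iff₀ h0] at h1
      have h2 : (n : ℝ) ≤ n' := h1.trans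
        (mul_le_of_le_one_right n'.cast_nonneg carpetRatio_lt_one.le)
      have h3 : N ≤ n' := hn.trans (by exact_mod_cast h2)
      have h4 : carpetRatio * z n' - z (colLen n') < -(ε * n') := not_le.1 (hN n' h3)
      rw [hn', colLen_ceil, ← hn'] at h4
      have h5 := mul_le_mul_of_nonneg_left (ih n' h3) h0.le
      have h6 : j * ε * n ≤ j * ε * (n' * carpetRatio) :=
        mul_le_mul_of_nonneg_left h1 (by positivity)
      have h7 : ε * n ≤ ε * n' := mul_le_mul_of_nonneg_left h2 hε.le
      push_cast
      nlinarith
  obtain ⟨j, hj⟩ := exists_nat_gt ε⁻¹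
  have h1 := (hgrow j (N + 1) (by omega)).trans (hz (N + 1))
  rw [inv_lt_iff_one_lt_mul₀ hε] at hj
  have h2 : (0 : ℝ) < (N + 1 : ℕ) := by positivity
  nlinarith

lemma dimH_carpet_le :
    dimH carpet ≤ ENNReal.ofReal (Real.log (1 + 2 ^ carpetRatio) / Real.log 2) := by
  have h2 : 0 < Real.log 2 := Real.log_pos (by norm_num)
  set u : ℝ := 2 ^ carpetRatio with hu
  have hu0 : 0 < u := by positivity
  have hZ0 : 0 < Real.log (1 + u) := Real.log_pos (by linarith)
  have key : ∀ ε : ℝ, 0 < ε →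
      dimH carpet ≤ ENNReal.ofReal (Real.log (1 + u) / Real.log 2 + ε) := by
    intro ε hε
    rw [carpet, ← image_univ]
    refine dimH_image_le_of_frequently (a := (1 + u)⁻¹) (by positivity)
      (inv_lt_one_of_one_lt₀ (by linarith)) (by positivity) fun ω _ => ?_
    refine (frequently_le_sub_colLen (z := fun n => n - onesCount ω n)
      (fun n => sub_nonneg.2 (onesCount_le ω n))
      (fun n => sub_le_self _ (onesCount_nonneg ω n)) hε).mono fun n hn => ?_
    have h1 : 1 - (1 + u)⁻¹ = u / (1 + u) := by
      field_simp
      ring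
    rw [logWeight, h1, Real.log_inv, Real.log_div hu0.ne' (by positivity), hu,
      Real.log_rpow (by norm_num), ← hu]
    have h3 := mul_le_mul_of_nonneg_right hn h2.le
    have h4 : (Real.log (1 + u) / Real.log 2 + ε) * Real.log 2 =
        Real.log (1 + u) + ε * Real.log 2 := by
      rw [add_mul, div_mul_cancel₀ _ h2.ne']
    rw [h4]
    linarith
  have hlim : Tendsto (fun ε : ℝ => ENNReal.ofReal (Real.log (1 + u) / Real.log 2 + ε)) (𝓝[>] 0)
      (𝓝 (ENNReal.ofReal (Real.log (1 + u) / Real.log 2 + 0))) := by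
    refine (ENNReal.continuous_ofReal.tendsto _).comp ?_
    exact ((continuous_const.add continuous_id).tendsto _).mono_left nhdsWithin_le_nhds
  rw [add_zero] at hlim
  exact ge_of_tendsto hlim (eventually_mem_nhdsWithin.mono fun ε hε => key ε hε)

lemma log_one_add_rpow_div_lt :
    Real.log (1 + 2 ^ carpetRatio) / Real.log 2 < 2 - carpetRatio := by
  have h2 : 0 < Real.log 2 := Real.log_pos (by norm_num)
  have h3 : 0 < Real.log 3 := Real.log_pos (by norm_num)
  have hθ : carpetRatio < 7 / 11 := by
    have h : Real.log (2 ^ 11) < Real.log (3 ^ 7) := Real.log_lt_log (by norm_num) (by norm_num)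
    rw [Real.log_pow, Real.log_pow] at h
    rw [carpetRatio, div_lt_iff₀ h3]
    push_cast at h
    linarith
  set u : ℝ := 2 ^ carpetRatio with hu
  have hu0 : 0 < u := by positivity
  have hu1 : u < 1.56 := by
    by_contra! hle
    have h11 : u ^ 11 < 2 ^ 7 := by
      rw [hu, ← Real.rpow_natCast, ← Real.rpow_mul (by norm_num), ← Real.rpow_natCast 2 7]
      refine Real.rpow_lt_rpow_of_exponent_lt (by norm_num) ?_
      push_cast
      linarith
    have := pow_le_pow_left₀ (by norm_num) hle 11
    norm_num at this h11
    linarith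
  rw [div_lt_iff₀ h2, sub_mul, lt_sub_iff_add_lt, ← Real.log_rpow (by norm_num) carpetRatio, ← hu,
    ← Real.log_mul (by positivity) hu0.ne']
  calc Real.log ((1 + u) * u) < Real.log (2 ^ 2) :=
        Real.log_lt_log (by positivity) (by nlinarith)
    _ = 2 * Real.log 2 := by rw [Real.log_pow]; norm_num

lemma dimH_carpet_toReal_lt : (dimH carpet).toReal < packingDim carpet := by
  refine lt_of_le_of_lt ?_ (log_one_add_rpow_div_lt.trans_le le_packingDim_carpet)
  have h2 : 0 < Real.log 2 := Real.log_pos (by norm_num)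
  have hpos : 0 ≤ Real.log (1 + 2 ^ carpetRatio) / Real.log 2 :=
    div_nonneg (Real.log_nonneg (le_add_of_nonneg_right (by positivity))) h2.le
  exact (ENNReal.toReal_mono ENNReal.ofReal_ne_top dimH_carpet_le).trans_eq
    (ENNReal.toReal_ofReal hpos)

lemma dimH_level {α : ℝ} (hα : α ∈ Icc (0 : ℝ) 1) :
    dimH (carpetCoding '' carpetLevel phiEx1 α) = ENNReal.ofReal (specEx1 α) :=
  le_antisymm ((dimH_le_packingDim _).trans (ENNReal.ofReal_le_ofReal (packingDim_level_le hα)))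
    (specEx1_le_dimH_level hα)

lemma packingDim_level {α : ℝ} (hα : α ∈ Icc (0 : ℝ) 1) :
    packingDim (carpetCoding '' carpetLevel phiEx1 α) = specEx1 α := by
  have hnonneg : 0 ≤ packingDim (carpetCoding '' carpetLevel phiEx1 α) :=
    le_packingDim_of_forall_cover fun C _ => ⟨0, upperBoxDim_nonneg _⟩
  refine le_antisymm (packingDim_level_le hα) ?_
  rw [← ENNReal.ofReal_le_ofReal_iff hnonneg]
  exact (specEx1_le_dimH_level hα).trans (dimH_le_packingDim _)

lemma specEx1_le_dimH_carpet {α : ℝ} (hα : α ∈ Icc (0 : ℝ) 1) :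
    specEx1 α ≤ (dimH carpet).toReal := by
  rw [← ENNReal.ofReal_le_iff_le_toReal (ne_top_of_le_ne_top ENNReal.ofReal_ne_top dimH_carpet_le)]
  exact (specEx1_le_dimH_level hα).trans (dimH_mono (image_subset_range _ _))

end CarpetHausdorff

/-- **Example 1.** On the Bedford–McMullen carpet with `a₁ = 3`, `a₂ = 2`,
`D = {(0,0),(1,1),(2,0)}`, the Hausdorff dimension of `Λ` is strictly smaller than its packing
dimension, yet the packing and Hausdorff spectra of `φ` coincide; in particular the packing
spectrum never attains `dim_P Λ`. -/
theorem bedford_mcmullen_example_one :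
    (dimH carpet).toReal < packingDim carpet ∧
    ∀ α ∈ Set.Icc (0 : ℝ) 1,
      packingDim (carpetCoding '' carpetLevel phiEx1 α) = specEx1 α ∧
      dimH (carpetCoding '' carpetLevel phiEx1 α) = ENNReal.ofReal (specEx1 α) ∧
      packingDim (carpetCoding '' carpetLevel phiEx1 α) < packingDim carpet := by
  refine ⟨dimH_carpet_toReal_lt, fun α hα => ⟨packingDim_level hα, dimH_level hα, ?_⟩⟩
  rw [packingDim_level hα]
  exact (specEx1_le_dimH_carpet hα).trans_lt dimH_carpet_toReal_lt

end
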